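/- For every integer d ≥ 5, setting F(k) = k(k+1)(k+2)·binom(k−1, d−3)/(2d) and G(k) = k(k+1)·binom(k−1, d−2)/d, one has dim_ℂ (Syz̄_d / Kos̄_d) = F(m)·F(n) + F(m)·G(n) + G(m)·F(n). (This is the degree-d part of the first Koszul homology of the generalized 2×2 permanents.) -/

import Mathlib

open MvPolynomial

/-- Index set for the generalized 2×2 permanents of a generic `m × n` matrix:
quadruples `((i,i'),(j,j'))` with `i ≤ i'` and `j ≤ j'`. -/
def PermIdx (m n : ℕ) : Type :=
  {w : (Fin m × Fin m) × (Fin n × Fin n) // w.1.1 ≤ w.1.2 ∧ w.2.1 ≤ w.2.2}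

instance (m n : ℕ) : Fintype (PermIdx m n) := by unfold PermIdx; infer_instance

instance (m n : ℕ) : DecidableEq (PermIdx m n) := by unfold PermIdx; infer_instance

/-- The generalized 2×2 permanent
`p_{(i,i'),(j,j')} = x_{i,j} x_{i',j'} + x_{i,j'} x_{i',j}`. -/
noncomputable def perm {m n : ℕ} (w : PermIdx m n) : MvPolynomial (Fin m × Fin n) ℂ :=
  X (w.1.1.1, w.1.2.1) * X (w.1.1.2, w.1.2.2) + X (w.1.1.1, w.1.2.2) * X (w.1.1.2, w.1.2.1)

/-- `Syz̄_d`: the ℂ-vector space of degree-`d` syzygies of the generalized 2×2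
permanents, i.e. families `c = (c_w)` of homogeneous polynomials of degree
`d - 2` with `∑_w c_w p_w = 0`. -/
noncomputable def SyzBar (m n d : ℕ) :
    Submodule ℂ (PermIdx m n → MvPolynomial (Fin m × Fin n) ℂ) where
  carrier := {c | (∀ w, c w ∈ homogeneousSubmodule (Fin m × Fin n) ℂ (d - 2)) ∧
    ∑ w, c w * perm w = 0}
  zero_mem' := by
    refine ⟨fun w => Submodule.zero_mem _, ?_⟩
    simp
  add_mem' := by
    rintro a b ⟨ha1, ha2⟩ ⟨hb1, hb2⟩
    refine ⟨fun w => Submodule.add_mem _ (ha1 w) (hb1 w), ?_⟩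
    simp only [Pi.add_apply, add_mul]
    rw [Finset.sum_add_distrib, ha2, hb2, add_zero]
  smul_mem' := by
    rintro r a ⟨ha1, ha2⟩
    refine ⟨fun w => Submodule.smul_mem _ r (ha1 w), ?_⟩
    simp only [Pi.smul_apply, smul_mul_assoc]
    rw [← Finset.smul_sum, ha2, smul_zero]

/-- The `S`-submodule of the free module `F = ⊕_w S·e_w` generated by the
Koszul syzygies `p_{w'}·e_w − p_w·e_{w'}`. -/
noncomputable def KosModBar (m n : ℕ) :
    Submodule (MvPolynomial (Fin m × Fin n) ℂ)
      (PermIdx m n → MvPolynomial (Fin m × Fin n) ℂ) :=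
  Submodule.span _ {k | ∃ w w' : PermIdx m n,
    k = Pi.single w (perm w') - Pi.single w' (perm w)}

/-- `Kos̄_d`: the space of degree-`d` syzygies lying in the `S`-submodule
generated by the Koszul syzygies. -/
noncomputable def KosBar (m n d : ℕ) :
    Submodule ℂ (PermIdx m n → MvPolynomial (Fin m × Fin n) ℂ) :=
  SyzBar m n d ⊓ Submodule.restrictScalars ℂ (KosModBar m n)

section PartA
set_option linter.unusedSectionVars false
open Equiv

section AbstractPart
variable {ι : Type*} [Fintype ι] [DecidableEq ι] {E : Type*} [NormedAddCommGroup E]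
  [InnerProductSpace ℂ E] [FiniteDimensional ℂ E]

/-- The operator `1 - T_{(i j)}`. -/
def opA (T : Perm ι →* (E →ₗ[ℂ] E)) (i j : ι) : E →ₗ[ℂ] E := 1 - T (swap i j)

lemma opA_apply (T : Perm ι →* (E →ₗ[ℂ] E)) (i j : ι) (x : E) :
    opA T i j x = x - T (swap i j) x := rfl

lemma opA_symm (T : Perm ι →* (E →ₗ[ℂ] E)) (i j : ι) : opA T i j = opA T j i := by
  simp [opA, swap_comm]

lemma opA_self (T : Perm ι →* (E →ₗ[ℂ] E)) (i : ι) (x : E) : opA T i i x = 0 := by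
  rw [opA_apply, swap_self]
  change x - T 1 x = 0
  simp

lemma opA_conj (T : Perm ι →* (E →ₗ[ℂ] E)) (g : Perm ι) (i j : ι) (x : E) :
    T g (opA T i j x) = opA T (g i) (g j) (T g x) := by
  have h : swap (g i) (g j) * g = g * swap i j := by
    ext k; simp [Equiv.swap_apply_def]; split_ifs <;> simp_all
  simp only [opA_apply, map_sub]
  rw [← Module.End.mul_apply, ← Module.End.mul_apply, ← map_mul, ← map_mul, h]

lemma opA_comm (T : Perm ι →* (E →ₗ[ℂ] E)) {i j k l : ι} (h1 : i ≠ k) (h2 : i ≠ l)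
    (h3 : j ≠ k) (h4 : j ≠ l) (x : E) :
    opA T i j (opA T k l x) = opA T k l (opA T i j x) := by
  have h := opA_conj T (swap i j) k l x
  rw [swap_apply_of_ne_of_ne h1.symm h3.symm, swap_apply_of_ne_of_ne h2.symm h4.symm] at h
  rw [opA_apply T i j, h, opA_apply T i j, map_sub]

lemma opA_comm3 (T : Perm ι →* (E →ₗ[ℂ] E)) {a b c : ι} (hac : a ≠ c) (hbc : b ≠ c) (x : E) :
    opA T a c (opA T a b x) + opA T b c (opA T a b x) =
    opA T a b (opA T a c x) + opA T a b (opA T b c x) := by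
  have h1 := opA_conj T (swap a b) a c x
  have h2 := opA_conj T (swap a b) b c x
  rw [swap_apply_left, swap_apply_of_ne_of_ne hac.symm hbc.symm] at h1
  rw [swap_apply_right, swap_apply_of_ne_of_ne hac.symm hbc.symm] at h2
  rw [opA_apply T a b x, opA_apply T a b (opA T a c x), opA_apply T a b (opA T b c x), h1, h2,
    map_sub, map_sub]
  abel

lemma opA_sq (T : Perm ι →* (E →ₗ[ℂ] E)) (i j : ι) (x : E) :
    opA T i j (opA T i j x) = (2 : ℂ) • opA T i j x := by
  simp only [opA_apply, map_sub]
  rw [← Module.End.mul_apply, ← map_mul, swap_mul_self, map_one, Module.End.one_apply, two_smul]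
  abel

lemma inner_swap (T : Perm ι →* (E →ₗ[ℂ] E)) (hT : ∀ g x y, inner ℂ (T g x) (T g y) = inner ℂ x y)
    (i j : ι) (x y : E) : inner ℂ (T (swap i j) x) y = inner ℂ x (T (swap i j) y) := by
  rw [← hT (swap i j), ← Module.End.mul_apply, ← map_mul, swap_mul_self, map_one,
    Module.End.one_apply]

lemma opA_inner (T : Perm ι →* (E →ₗ[ℂ] E)) (hT : ∀ g x y, inner ℂ (T g x) (T g y) = inner ℂ x y)
    (i j : ι) (x y : E) : inner ℂ (opA T i j x) y = inner ℂ x (opA T i j y) := by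
  simp only [opA_apply, inner_sub_left, inner_sub_right, inner_swap T hT]

/-- solving `Λ μ = w` for a sum of scaled projections -/
lemma exists_sol {κ : Type*} [Fintype κ] (P : κ → E →ₗ[ℂ] E)
    (hs : ∀ i x y, inner ℂ (P i x) y = inner ℂ x (P i y))
    (r : ℝ) (hr : 0 < r) (hP : ∀ i x, P i (P i x) = (r : ℂ) • P i x) :
    (∀ v, (∑ i, P i v) = 0 → ∀ i, P i v = 0) ∧
    (∀ y : κ → E, ∃ μ, ∑ i, P i μ = ∑ i, P i (y i)) := by
  have hnorm : ∀ i v, inner ℂ (P i v) v = ((r⁻¹ * ‖P i v‖ ^ 2 : ℝ) : ℂ) := by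
    intro i v
    have h1 : inner ℂ (P i v) (P i v) = (r : ℂ) * inner ℂ (P i v) v := by
      rw [← hs, hP, inner_smul_left]; simp
    rw [inner_self_eq_norm_sq_to_K] at h1
    have hr' : (r : ℂ) ≠ 0 := by exact_mod_cast hr.ne'
    push_cast
    field_simp
    rw [mul_comm, ← h1]; rfl
  have hker : ∀ v, (∑ i, P i v) = 0 → ∀ i, P i v = 0 := by
    intro v hv
    have h0 : ∑ i, inner ℂ (P i v) v = 0 := by rw [← sum_inner, hv, inner_zero_left]
    simp only [hnorm] at h0
    rw [← Complex.ofReal_sum, Complex.ofReal_eq_zero,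
      Finset.sum_eq_zero_iff_of_nonneg (fun i _ => by positivity)] at h0
    intro i
    have := h0 i (Finset.mem_univ _)
    have h2 : ‖P i v‖ ^ 2 = 0 := by
      rcases mul_eq_zero.1 this with h | h
      · exact absurd h (by positivity)
      · exact h
    simpa using h2
  refine ⟨hker, fun y => ?_⟩
  let Λ : E →ₗ[ℂ] E := ∑ i, P i
  have hΛ : ∀ v, Λ v = ∑ i, P i v := fun v => by simp [Λ]
  have hsym : Λ.IsSymmetric := by
    intro x y
    simp only [hΛ, sum_inner, inner_sum, hs]
  have hmem : ∑ i, P i (y i) ∈ (LinearMap.ker Λ)ᗮ := by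
    rw [Submodule.mem_orthogonal]
    intro v hv
    rw [LinearMap.mem_ker, hΛ] at hv
    rw [inner_sum]
    refine Finset.sum_eq_zero fun i _ => ?_
    rw [← hs, hker v hv i, inner_zero_left]
  have hadj : LinearMap.adjoint Λ = Λ := (LinearMap.isSymmetric_iff_isSelfAdjoint Λ).1 hsym
  rw [LinearMap.orthogonal_ker, hadj] at hmem
  obtain ⟨μ, hμ⟩ := hmem
  exact ⟨μ, by rw [← hΛ, hμ]⟩

/-- if `v = P z`, `P` symmetric, `ker Λ ≤ ker P`, `Λ v = 0` then `v = 0`. -/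
lemma eq_zero_of_sym (P : E →ₗ[ℂ] E) (hs : ∀ x y, inner ℂ (P x) y = inner ℂ x (P y))
    (z : E) (h : P (P z) = 0) : P z = 0 := by
  rw [← inner_self_eq_zero (𝕜 := ℂ), hs, h, inner_zero_right]

/-- A twisted cocycle. -/
structure IsCoc (T : Perm ι →* (E →ₗ[ℂ] E)) (m : ι → ι → E) : Prop where
  diag : ∀ i, m i i = 0
  symm : ∀ i j, m i j = m j i
  anti : ∀ i j, i ≠ j → T (swap i j) (m i j) = - m i j
  kos : ∀ i j k l, i ≠ j → k ≠ l → i ≠ k → i ≠ l → j ≠ k → j ≠ l →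
    opA T k l (m i j) = opA T i j (m k l)

lemma IsCoc.two {T : Perm ι →* (E →ₗ[ℂ] E)} {m : ι → ι → E} (h : IsCoc T m) (i j : ι) :
    opA T i j (m i j) = (2 : ℂ) • m i j := by
  by_cases hij : i = j
  · subst hij; simp [h.diag]
  · rw [opA_apply, h.anti i j hij, two_smul]; abel

lemma IsCoc.sub_cob {T : Perm ι →* (E →ₗ[ℂ] E)} {m : ι → ι → E} (h : IsCoc T m) (μ : E) :
    IsCoc T (fun i j => m i j - opA T i j μ) := by
  refine ⟨fun i => by simp [h.diag, opA_self], fun i j => by rw [h.symm, opA_symm], ?_, ?_⟩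
  · intro i j hij
    have := opA_sq T i j μ
    rw [opA_apply, two_smul] at this
    rw [map_sub, h.anti i j hij]
    have h2 : T (swap i j) (opA T i j μ) = - opA T i j μ := by
      rw [sub_eq_iff_eq_add] at this
      have h3 : opA T i j μ + (opA T i j μ + T (swap i j) (opA T i j μ)) = opA T i j μ + 0 := by
        rw [add_zero, ← add_assoc]; exact this.symm
      exact eq_neg_of_add_eq_zero_right (add_left_cancel h3)
    rw [h2]; abel
  · intro i j k l h1 h2 h3 h4 h5 h6
    rw [map_sub, map_sub, h.kos i j k l h1 h2 h3 h4 h5 h6, opA_comm T h3 h4 h5 h6]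

lemma IsCoc.lam {T : Perm ι →* (E →ₗ[ℂ] E)} {m : ι → ι → E} (h : IsCoc T m)
    {a b d e c : ι} (hab : a ≠ b) (hde : d ≠ e) (had : a ≠ d) (hae : a ≠ e) (hbd : b ≠ d)
    (hbe : b ≠ e) (hac : a ≠ c) (hbc : b ≠ c) (hdc : d ≠ c) (hec : e ≠ c) :
    ∑ x, opA T x c (opA T d e (m a b)) = opA T a b (opA T d e (∑ x, m x c)) := by
  rw [map_sum, map_sum, ← sub_eq_zero, ← Finset.sum_sub_distrib]
  have hsub : ∀ x ∈ Finset.univ, x ∉ ({a, b, d, e} : Finset ι) →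
      opA T x c (opA T d e (m a b)) - opA T a b (opA T d e (m x c)) = 0 := by
    intro x _ hx
    simp only [Finset.mem_insert, Finset.mem_singleton, not_or] at hx
    obtain ⟨h1, h2, h3, h4⟩ := hx
    by_cases hxc : x = c
    · subst hxc; simp [opA_self, h.diag]
    · rw [opA_comm T h3 h4 hdc.symm hec.symm, opA_comm T had hae hbd hbe,
        h.kos a b x c hab hxc (Ne.symm h1) hac (Ne.symm h2) hbc, sub_self]
  rw [← Finset.sum_subset (Finset.subset_univ _) hsub,
    Finset.sum_insert (by simp [*]), Finset.sum_insert (by simp [*]),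
    Finset.sum_insert (by simp [*]), Finset.sum_singleton]
  have k1 := h.kos a b d e hab hde had hae hbd hbe
  have k2 := opA_comm3 T hac hbc (m d e)
  have k3 := opA_comm3 T hdc hec (m a b)
  have k4 := h.kos a c d e hac hde had hae hdc.symm hec.symm
  have k5 := h.kos b c d e hbc hde hbd hbe hdc.symm hec.symm
  have k6 := h.kos d c a b hdc hab had.symm hbd.symm hac.symm hbc.symm
  have k7 := h.kos e c a b hec hab hae.symm hbe.symm hac.symm hbc.symm
  have k8 := opA_comm T had hae hbd hbe (m d c)
  have k9 := opA_comm T had hae hbd hbe (m e c)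
  rw [← k1] at k2
  rw [k8, k9, k4, k5, k6, k7]
  linear_combination (norm := module) k2 + k3

end AbstractPart

end PartA

section PartA2
set_option linter.unusedSectionVars false
open Equiv

section AbstractPart2
variable {ι : Type*} [Fintype ι] [DecidableEq ι] {E : Type*} [NormedAddCommGroup E]
  [InnerProductSpace ℂ E] [FiniteDimensional ℂ E]

/-- four distinct indices -/
def Dist4 (a b d e : ι) : Prop := a ≠ b ∧ d ≠ e ∧ a ≠ d ∧ a ≠ e ∧ b ≠ d ∧ b ≠ e

instance (a b d e : ι) : Decidable (Dist4 a b d e) := by unfold Dist4; infer_instance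

lemma opA_fix {T : Perm ι →* (E →ₗ[ℂ] E)} {a b : ι} {x : E} (h : opA T a b x = 0) :
    T (swap a b) x = x := by
  rw [opA_apply, sub_eq_zero] at h; exact h.symm

lemma IsCoc.normalise {T : Perm ι →* (E →ₗ[ℂ] E)}
    (hT : ∀ g x y, inner ℂ (T g x) (T g y) = inner ℂ x y) {m : ι → ι → E} (h : IsCoc T m) (c : ι) :
    ∃ μ : E, ∀ a b d e, Dist4 a b d e → a ≠ c → b ≠ c → d ≠ c → e ≠ c →
      opA T d e (m a b - opA T a b μ) = 0 := by
  obtain ⟨μ, hμ⟩ := (exists_sol (fun x => opA T x c) (fun i => opA_inner T hT i c) 2 (by norm_num)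
    (fun i x => by rw [opA_sq]; norm_num)).2 (fun x => (2⁻¹ : ℂ) • m x c)
  have hμ' : ∑ x, opA T x c μ = ∑ x, m x c := by
    rw [hμ]
    refine Finset.sum_congr rfl fun x _ => ?_
    rw [map_smul, h.two, smul_smul]; norm_num
  refine ⟨μ, ?_⟩
  rintro a b d e ⟨hab, hde, had, hae, hbd, hbe⟩ hac hbc hdc hec
  have h' := h.sub_cob μ
  have hl := h'.lam hab hde had hae hbd hbe hac hbc hdc hec
  rw [Finset.sum_sub_distrib, hμ', sub_self, map_zero, map_zero] at hl
  have hz := (exists_sol (fun x => opA T x c) (fun i => opA_inner T hT i c) 2 (by norm_num)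
    (fun i x => by rw [opA_sq]; norm_num)).1 _ hl
  have ha := opA_fix (hz a)
  have hb := opA_fix (hz b)
  set u := opA T d e (m a b - opA T a b μ) with hu
  have hsw : swap a b = swap a c * swap b c * swap a c := by
    ext k
    simp only [Perm.mul_apply, swap_apply_def]
    split_ifs <;> simp_all
  have hab' : T (swap a b) u = u := by
    rw [hsw, map_mul, map_mul, Module.End.mul_apply, Module.End.mul_apply, ha, hb, ha]
  have h2 : opA T a b u = (2 : ℂ) • u := by
    rw [hu, opA_comm T had hae hbd hbe]
    have := h'.two a b
    rw [this, map_smul]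
  rw [opA_apply, hab', sub_self] at h2
  have := smul_eq_zero.1 h2.symm
  simpa using this

lemma IsCoc.zrel {T : Perm ι →* (E →ₗ[ℂ] E)} {m : ι → ι → E} (h : IsCoc T m)
    {a d e f c : ι} (hfc : f ≠ c) (hfa : f ≠ a) (hfd : f ≠ d) (hfe : f ≠ e)
    (hca : c ≠ a) (hcd : c ≠ d) (hce : c ≠ e) (had : a ≠ d) (hae : a ≠ e) (hde : d ≠ e) :
    opA T f c (opA T d e (m a d)) + opA T f c (opA T d e (m a e)) =
      opA T f c (opA T a d (m d e) + opA T a e (m d e)) := by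
  rw [opA_comm T hfd hfe hcd hce, opA_comm T hfd hfe hcd hce,
    h.kos a d f c had hfc hfa.symm hca.symm hfd.symm hcd.symm,
    h.kos a e f c hae hfc hfa.symm hca.symm hfe.symm hce.symm, map_add,
    opA_comm T hfa hfd hca hcd, opA_comm T hfa hfe hca hce,
    ← h.kos f c d e hfc hde hfd hfe hcd hce]
  have := opA_comm3 T had.symm hae.symm (m f c)
  rw [opA_symm T a d, opA_symm T a e, this]

/-- normalised sum -/
def Vsum (m : ι → ι → E) (c x : ι) : E :=
  ∑ g ∈ (Finset.univ.erase c).erase x, ∑ h ∈ (Finset.univ.erase c).erase x, m g h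

/-- the explicit element -/
def Ysum (T : Perm ι →* (E →ₗ[ℂ] E)) (μ : E) (c d e x : ι) : E :=
  opA T x c ((4 : ℂ) • μ + (2 : ℂ) •
    ∑ g ∈ (((Finset.univ.erase c).erase x).erase d).erase e, (opA T g d μ + opA T g e μ))

lemma IsCoc.vsum_eq {T : Perm ι →* (E →ₗ[ℂ] E)} {m : ι → ι → E} (h : IsCoc T m) (c : ι)
    (hn : ∀ a b d e, Dist4 a b d e → a ≠ c → b ≠ c → d ≠ c → e ≠ c → opA T d e (m a b) = 0)
    {d e x : ι} (hde : d ≠ e) (hdc : d ≠ c) (hec : e ≠ c) (hxd : x ≠ d) (hxe : x ≠ e)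
    (hxc : x ≠ c) :
    opA T d e (opA T x c (Vsum m c x)) = Ysum T (m d e) c d e x := by
  rw [opA_comm T hxd.symm hdc hxe.symm hec, Vsum, Ysum]
  set J := (((Finset.univ.erase c).erase x).erase d).erase e with hJ
  have hK : (Finset.univ.erase c).erase x = insert d (insert e J) := by
    rw [hJ, Finset.insert_erase (by simp [hde.symm, hxe.symm, hec]),
      Finset.insert_erase (by simp [hxd.symm, hdc])]
  have heJ : e ∉ J := by simp [hJ]
  have hdJ : d ∉ insert e J := by simp [hJ, hde]
  rw [hK]
  simp only [Finset.sum_insert hdJ, Finset.sum_insert heJ, h.diag, map_add, map_sum]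
  have hmem : ∀ g ∈ J, g ≠ e ∧ g ≠ d ∧ g ≠ x ∧ g ≠ c := by
    intro g hg; simpa [hJ] using hg
  have h0 : ∑ g ∈ J, ∑ k ∈ J, opA T x c (opA T d e (m g k)) = 0 := by
    refine Finset.sum_eq_zero fun g hg => Finset.sum_eq_zero fun k hk => ?_
    obtain ⟨g1, g2, g3, g4⟩ := hmem g hg
    obtain ⟨k1, k2, k3, k4⟩ := hmem k hk
    by_cases hgk : g = k
    · subst hgk; simp [h.diag]
    · rw [hn g k d e ⟨hgk, hde, g2, g1, k2, k1⟩ g4 k4 hdc hec, map_zero]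
  have h1 : ∑ g ∈ J, opA T x c (opA T d e (m g d)) + ∑ g ∈ J, opA T x c (opA T d e (m g e)) =
      opA T x c (∑ g ∈ J, (opA T g d (m d e) + opA T g e (m d e))) := by
    rw [← Finset.sum_add_distrib, map_sum]
    refine Finset.sum_congr rfl fun g hg => ?_
    obtain ⟨g1, g2, g3, g4⟩ := hmem g hg
    exact h.zrel hxc g3.symm hxd hxe g4.symm hdc.symm hec.symm g2 g1 hde
  have h2 : ∀ f : ι, ∑ g ∈ J, opA T x c (opA T d e (m f g)) =
      ∑ g ∈ J, opA T x c (opA T d e (m g f)) := fun f =>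
    Finset.sum_congr rfl fun g _ => by rw [h.symm]
  have h3 : opA T x c (opA T d e (m e d)) = opA T x c (opA T d e (m d e)) := by rw [h.symm]
  have h4 : opA T x c (opA T d e (m d e)) = (2 : ℂ) • opA T x c (m d e) := by
    rw [h.two, map_smul]
  simp only [Finset.sum_add_distrib, map_zero, h2 d, h2 e, h0, h3, h4, map_smul, map_add, map_sum] at h1 ⊢
  linear_combination (norm := module) (2 : ℂ) • h1

lemma IsCoc.key {T : Perm ι →* (E →ₗ[ℂ] E)} {m : ι → ι → E} (h : IsCoc T m) (c : ι)
    (hn : ∀ a b d e, Dist4 a b d e → a ≠ c → b ≠ c → d ≠ c → e ≠ c → opA T d e (m a b) = 0)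
    {a b d e : ι} (hp : Dist4 a b d e) (hac : a ≠ c) (hbc : b ≠ c) (hdc : d ≠ c) (hec : e ≠ c)
    (X : Finset ι) (hX : ∀ x ∈ X, swap a b x ∈ X) (hX1 : ∀ x ∈ X, x ≠ c ∧ x ≠ d ∧ x ≠ e) :
    opA T a b (opA T d e (∑ x ∈ X, opA T x c (Vsum m c x))) = 0 := by
  have hp' := hp
  obtain ⟨hab, hde, had, hae, hbd, hbe⟩ := hp
  have h1 : opA T d e (∑ x ∈ X, opA T x c (Vsum m c x)) = ∑ x ∈ X, Ysum T (m d e) c d e x := by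
    rw [map_sum]
    refine Finset.sum_congr rfl fun x hx => ?_
    obtain ⟨x1, x2, x3⟩ := hX1 x hx
    exact h.vsum_eq c hn hde hdc hec x2 x3 x1
  have hfix : T (swap a b) (m d e) = m d e :=
    opA_fix (hn d e a b ⟨hde, hab, had.symm, hbd.symm, hae.symm, hbe.symm⟩ hdc hec hac hbc)
  have hc : swap a b c = c := swap_apply_of_ne_of_ne hac.symm hbc.symm
  have hd : swap a b d = d := swap_apply_of_ne_of_ne had.symm hbd.symm
  have he : swap a b e = e := swap_apply_of_ne_of_ne hae.symm hbe.symm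
  have hY : ∀ x, T (swap a b) (Ysum T (m d e) c d e x) = Ysum T (m d e) c d e (swap a b x) := by
    intro x
    rw [Ysum, opA_conj, hc, Ysum]
    congr 1
    simp only [map_add, map_smul, map_sum, opA_conj, hd, he, hfix]
    congr 2
    refine Finset.sum_equiv (swap a b) ?_ (fun _ _ => rfl)
    intro g
    have e1 : ∀ y z : ι, swap a b y = z ↔ y = swap a b z := fun y z => by
      constructor
      · rintro rfl; simp
      · rintro rfl; simp
    simp [e1, hc, hd, he]
  rw [h1, opA_apply, map_sum, sub_eq_zero]
  symm
  simp only [hY]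
  refine Finset.sum_nbij' (swap a b) (swap a b) hX hX ?_ ?_ ?_ <;> simp

lemma IsCoc.keyW {T : Perm ι →* (E →ₗ[ℂ] E)} {m : ι → ι → E} (h : IsCoc T m) (c : ι)
    (hn : ∀ a b d e, Dist4 a b d e → a ≠ c → b ≠ c → d ≠ c → e ≠ c → opA T d e (m a b) = 0)
    {a b d e : ι} (hp : Dist4 a b d e) (hac : a ≠ c) (hbc : b ≠ c) (hdc : d ≠ c) (hec : e ≠ c) :
    opA T a b (opA T d e (∑ x, opA T x c (Vsum m c x))) = 0 := by
  have hp' := hp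
  obtain ⟨hab, hde, had, hae, hbd, hbe⟩ := hp
  have hs : ∑ x, opA T x c (Vsum m c x) = ∑ x ∈ ({d, e} : Finset ι), opA T x c (Vsum m c x) +
      ∑ x ∈ Finset.univ \ {c, d, e}, opA T x c (Vsum m c x) := by
    rw [← Finset.sum_sdiff (Finset.subset_univ {c, d, e}), add_comm]
    congr 1
    rw [Finset.sum_insert (by simp [hdc.symm, hec.symm]), opA_self, zero_add]
  have k1 := h.key c hn hp' hac hbc hdc hec (Finset.univ \ {c, d, e}) (by
    intro x hx
    simp only [Finset.mem_sdiff, Finset.mem_univ, Finset.mem_insert, Finset.mem_singleton,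
      true_and, not_or] at hx ⊢
    rw [swap_apply_def]; split_ifs <;> simp_all) (by
    intro x hx
    simpa using hx)
  have k2 := h.key c hn ⟨hde, hab, had.symm, hbd.symm, hae.symm, hbe.symm⟩ hdc hec hac hbc
    {d, e} (by simp) (by
    intro x hx
    simp only [Finset.mem_insert, Finset.mem_singleton] at hx
    rcases hx with rfl | rfl
    · exact ⟨hdc, had.symm, hbd.symm⟩
    · exact ⟨hec, hae.symm, hbe.symm⟩)
  rw [hs, map_add, map_add, k1, add_zero, opA_comm T had hae hbd hbe, k2]

/-- the double difference -/
def uu (T : Perm ι →* (E →ₗ[ℂ] E)) (m : ι → ι → E) (i j k l : ι) : E :=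
  if Dist4 i j k l then opA T k l (m i j) else 0

/-- the double difference operator -/
def dd (T : Perm ι →* (E →ₗ[ℂ] E)) (t : ι × ι × ι × ι) : E →ₗ[ℂ] E :=
  if Dist4 t.1 t.2.1 t.2.2.1 t.2.2.2 then opA T t.1 t.2.1 ∘ₗ opA T t.2.2.1 t.2.2.2 else 0

lemma Dist4.symm1 {i j k l : ι} : Dist4 i j k l ↔ Dist4 j i k l := by unfold Dist4; tauto
lemma Dist4.swap {i j k l : ι} : Dist4 i j k l ↔ Dist4 k l i j := by
  unfold Dist4; simp only [ne_comm]; tauto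

lemma IsCoc.uu1 {T : Perm ι →* (E →ₗ[ℂ] E)} {m : ι → ι → E} (h : IsCoc T m) (i j k l : ι) :
    uu T m i j k l = uu T m j i k l := by
  unfold uu; rw [h.symm]
  simp only [Dist4.symm1 (i := i)]

lemma IsCoc.uu2 {T : Perm ι →* (E →ₗ[ℂ] E)} {m : ι → ι → E} (h : IsCoc T m) (i j k l : ι) :
    uu T m i j k l = uu T m k l i j := by
  unfold uu
  by_cases hp : Dist4 i j k l
  · rw [if_pos hp, if_pos (Dist4.swap.1 hp)]
    obtain ⟨h1, h2, h3, h4, h5, h6⟩ := hp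
    exact h.kos i j k l h1 h2 h3 h4 h5 h6
  · rw [if_neg hp, if_neg (fun h => hp (Dist4.swap.1 h))]

lemma IsCoc.uu_split {T : Perm ι →* (E →ₗ[ℂ] E)} {m : ι → ι → E} (c : ι)
    (hn : ∀ a b d e, Dist4 a b d e → a ≠ c → b ≠ c → d ≠ c → e ≠ c → opA T d e (m a b) = 0)
    (i j k l : ι) : uu T m i j k l = (if i = c then uu T m i j k l else 0) +
      (if j = c then uu T m i j k l else 0) + (if k = c then uu T m i j k l else 0) +
      (if l = c then uu T m i j k l else 0) := by
  by_cases hp : Dist4 i j k l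
  · have h0 : i ≠ c → j ≠ c → k ≠ c → l ≠ c → uu T m i j k l = 0 := fun h1 h2 h3 h4 => by
      rw [uu, if_pos hp, hn i j k l hp h1 h2 h3 h4]
    obtain ⟨h1, h2, h3, h4, h5, h6⟩ := hp
    by_cases hi : i = c
    · subst hi; simp [h1.symm, h3.symm, h4.symm]
    by_cases hj : j = c
    · subst hj; simp [h1, h5.symm, h6.symm]
    by_cases hk : k = c
    · subst hk; simp [h3, h5, h2.symm]
    by_cases hl : l = c
    · subst hl; simp [h4, h6, h2]
    simp [hi, hj, hk, hl, h0]
  · simp [uu, hp]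

lemma sum_rot (f : ι → ι → ι → E) :
    ∑ a, ∑ b, ∑ e, f b e a = ∑ a, ∑ b, ∑ e, f a b e := by
  rw [Finset.sum_comm]
  exact Finset.sum_congr rfl fun _ _ => Finset.sum_comm

lemma IsCoc.U_eq {T : Perm ι →* (E →ₗ[ℂ] E)} {m : ι → ι → E} (h : IsCoc T m) (c : ι)
    (hn : ∀ a b d e, Dist4 a b d e → a ≠ c → b ≠ c → d ≠ c → e ≠ c → opA T d e (m a b) = 0) :
    ∑ i, ∑ j, ∑ k, ∑ l, uu T m i j k l = (4 : ℂ) • ∑ x, opA T x c (Vsum m c x) := by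
  have hW : ∑ x, opA T x c (Vsum m c x) = ∑ k, ∑ i, ∑ j, uu T m i j k c := by
    refine Finset.sum_congr rfl fun k _ => ?_
    rw [Vsum]
    simp only [map_sum]
    rw [← Finset.sum_subset (Finset.subset_univ ((Finset.univ.erase c).erase k))]
    · refine Finset.sum_congr rfl fun i hi => ?_
      rw [← Finset.sum_subset (Finset.subset_univ ((Finset.univ.erase c).erase k))]
      · refine Finset.sum_congr rfl fun j hj => ?_
        simp only [Finset.mem_erase, Finset.mem_univ, and_true] at hi hj
        by_cases hij : i = j
        · subst hij; simp [uu, h.diag]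
        by_cases hk : k = c
        · subst hk; simp [uu, opA_self]
        rw [uu, if_pos ⟨hij, hk, hi.1, hi.2, hj.1, hj.2⟩]
      · intro j _ hj
        rw [uu, if_neg]
        rintro ⟨h1, h2, h3, h4, h5, h6⟩
        exact hj (by simp [h5, h6])
    · intro i _ hi
      refine Finset.sum_eq_zero fun j _ => ?_
      rw [uu, if_neg]
      rintro ⟨h1, h2, h3, h4, h5, h6⟩
      exact hi (by simp [h3, h4])
  rw [hW, sum_rot (fun i j k => uu T m i j k c)]
  have e1 : ∑ i, ∑ j, ∑ k, ∑ l, (if i = c then uu T m i j k l else 0) =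
      ∑ i, ∑ j, ∑ k, uu T m i j k c := by
    rw [← sum_rot (fun i j k => uu T m i j k c), Finset.sum_eq_single c]
    · simp only [if_true]
      refine Finset.sum_congr rfl fun j _ => Finset.sum_congr rfl fun k _ =>
        Finset.sum_congr rfl fun l _ => ?_
      rw [h.uu1, h.uu2]
    · intro b _ hb; simp [hb]
    · simp
  have e2 : ∑ i, ∑ j, ∑ k, ∑ l, (if j = c then uu T m i j k l else 0) =
      ∑ i, ∑ j, ∑ k, uu T m i j k c := by
    rw [← sum_rot (fun i j k => uu T m i j k c)]
    refine Finset.sum_congr rfl fun i _ => ?_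
    rw [Finset.sum_eq_single c]
    · simp only [if_true]
      refine Finset.sum_congr rfl fun k _ => Finset.sum_congr rfl fun l _ => ?_
      rw [h.uu2]
    · intro b _ hb; simp [hb]
    · simp
  have e3 : ∑ i, ∑ j, ∑ k, ∑ l, (if k = c then uu T m i j k l else 0) =
      ∑ i, ∑ j, ∑ k, uu T m i j k c := by
    refine Finset.sum_congr rfl fun i _ => Finset.sum_congr rfl fun j _ => ?_
    rw [Finset.sum_eq_single c]
    · simp only [if_true]
      refine Finset.sum_congr rfl fun l _ => ?_
      rw [h.uu2, h.uu1, h.uu2]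
    · intro b _ hb; simp [hb]
    · simp
  have e4 : ∑ i, ∑ j, ∑ k, ∑ l, (if l = c then uu T m i j k l else 0) =
      ∑ i, ∑ j, ∑ k, uu T m i j k c := by
    simp only [Finset.sum_ite_eq', Finset.mem_univ, if_true]
  have es : ∑ i, ∑ j, ∑ k, ∑ l, uu T m i j k l =
    ∑ i, ∑ j, ∑ k, ∑ l, ((if i = c then uu T m i j k l else 0) +
      (if j = c then uu T m i j k l else 0) + (if k = c then uu T m i j k l else 0) +
      (if l = c then uu T m i j k l else 0)) :=
    Finset.sum_congr rfl fun i _ => Finset.sum_congr rfl fun j _ =>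
      Finset.sum_congr rfl fun k _ => Finset.sum_congr rfl fun l _ => IsCoc.uu_split c hn i j k l
  rw [es]
  simp only [Finset.sum_add_distrib, e1, e2, e3, e4]
  module

lemma dd_inner (T : Perm ι →* (E →ₗ[ℂ] E)) (hT : ∀ g x y, inner ℂ (T g x) (T g y) = inner ℂ x y)
    (t : ι × ι × ι × ι) (x y : E) : inner ℂ (dd T t x) y = inner ℂ x (dd T t y) := by
  unfold dd
  split_ifs with hp
  · obtain ⟨h1, h2, h3, h4, h5, h6⟩ := hp
    simp only [LinearMap.comp_apply]
    rw [opA_inner T hT, opA_inner T hT, opA_comm T h3 h4 h5 h6]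
  · simp

lemma dd_sq (T : Perm ι →* (E →ₗ[ℂ] E)) (t : ι × ι × ι × ι) (x : E) :
    dd T t (dd T t x) = (4 : ℂ) • dd T t x := by
  unfold dd
  split_ifs with hp
  · obtain ⟨h1, h2, h3, h4, h5, h6⟩ := hp
    simp only [LinearMap.comp_apply]
    rw [← opA_comm T h3 h4 h5 h6, opA_sq, opA_sq, map_smul, smul_smul]
    norm_num
  · simp

/-- the sum operator -/
def OmOp (T : Perm ι →* (E →ₗ[ℂ] E)) : E →ₗ[ℂ] E := ∑ t, dd T t

lemma OmOp_comm (T : Perm ι →* (E →ₗ[ℂ] E)) (g : Perm ι) (x : E) :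
    T g (OmOp T x) = OmOp T (T g x) := by
  simp only [OmOp, LinearMap.sum_apply, map_sum]
  refine Fintype.sum_equiv (g.prodCongr (g.prodCongr (g.prodCongr g))) _ _ fun t => ?_
  obtain ⟨i, j, k, l⟩ := t
  have hd : Dist4 (g i) (g j) (g k) (g l) ↔ Dist4 i j k l := by simp [Dist4]
  simp only [dd, prodCongr_apply, Prod.map, hd]
  split_ifs with hp
  · simp [opA_conj]
  · simp

lemma OmOp_comm_opA (T : Perm ι →* (E →ₗ[ℂ] E)) (i j : ι) (x : E) :
    opA T i j (OmOp T x) = OmOp T (opA T i j x) := by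
  simp only [opA_apply, map_sub, OmOp_comm]

theorem IsCoc.main (hcard : 5 ≤ Fintype.card ι) {T : Perm ι →* (E →ₗ[ℂ] E)}
    (hT : ∀ g x y, inner ℂ (T g x) (T g y) = inner ℂ x y) {m : ι → ι → E} (h : IsCoc T m) :
    ∃ m0 : E, ∀ i j k l, Dist4 i j k l → opA T k l (m i j) = opA T i j (opA T k l m0) := by
  set U := ∑ i, ∑ j, ∑ k, ∑ l, uu T m i j k l with hU
  have hOm : ∀ v, OmOp T v = ∑ t, dd T t v := fun v => by simp [OmOp]
  have key : ∀ a b d e, Dist4 a b d e → opA T a b (opA T d e U) = OmOp T (opA T d e (m a b)) := by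
    intro a b d e hp
    obtain ⟨c, hc⟩ : ∃ c, c ∉ ({a, b, d, e} : Finset ι) := by
      by_contra hcon
      push Not at hcon
      have h1 : Finset.univ ⊆ ({a, b, d, e} : Finset ι) := fun x _ => hcon x
      have h2 := Finset.card_le_card h1
      have h3 := Finset.card_le_four (a := a) (b := b) (c := d) (d := e)
      rw [Finset.card_univ] at h2
      omega
    simp only [Finset.mem_insert, Finset.mem_singleton, not_or] at hc
    obtain ⟨c1, c2, c3, c4⟩ := hc
    obtain ⟨μ, hμ⟩ := h.normalise hT c
    have h' := h.sub_cob μ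
    have hUU := h'.U_eq c hμ
    have hW := h'.keyW c hμ hp (Ne.symm c1) (Ne.symm c2) (Ne.symm c3) (Ne.symm c4)
    have hUs : U = ∑ i, ∑ j, ∑ k, ∑ l, uu T (fun i j => m i j - opA T i j μ) i j k l +
        OmOp T μ := by
      rw [hOm]
      simp only [Fintype.sum_prod_type, ← Finset.sum_add_distrib, hU]
      refine Finset.sum_congr rfl fun i _ => Finset.sum_congr rfl fun j _ =>
        Finset.sum_congr rfl fun k _ => Finset.sum_congr rfl fun l _ => ?_
      simp only [uu, dd]
      split_ifs with hq
      · obtain ⟨h1, h2, h3, h4, h5, h6⟩ := hq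
        rw [map_sub, LinearMap.comp_apply, opA_comm T h3 h4 h5 h6]
        abel
      · simp
    have hu := hμ a b d e hp (Ne.symm c1) (Ne.symm c2) (Ne.symm c3) (Ne.symm c4)
    rw [map_sub, sub_eq_zero] at hu
    rw [hUs, hUU, map_add, map_add, map_smul, map_smul, hW, smul_zero, zero_add, hu,
      OmOp_comm_opA, OmOp_comm_opA]
    obtain ⟨h1, h2, h3, h4, h5, h6⟩ := hp
    rw [opA_comm T h3 h4 h5 h6]
  have hsol := exists_sol (fun t => dd T t) (dd_inner T hT) 4 (by norm_num)
    (fun t x => by rw [dd_sq]; norm_num)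
  obtain ⟨m0, hm0⟩ := hsol.2 (fun t => (2⁻¹ : ℂ) • m t.1 t.2.1)
  have hUm : OmOp T m0 = U := by
    rw [hOm, hm0, hU]
    simp only [Fintype.sum_prod_type]
    refine Finset.sum_congr rfl fun i _ => Finset.sum_congr rfl fun j _ =>
        Finset.sum_congr rfl fun k _ => Finset.sum_congr rfl fun l _ => ?_
    simp only [uu, dd]
    split_ifs with hq
    · obtain ⟨h1, h2, h3, h4, h5, h6⟩ := hq
      rw [LinearMap.comp_apply, opA_comm T h3 h4 h5 h6, map_smul, h.two, smul_smul]
      norm_num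
    · simp
  refine ⟨m0, fun i j k l hp => ?_⟩
  have h0 : OmOp T (opA T k l (m i j) - opA T i j (opA T k l m0)) = 0 := by
    rw [map_sub, ← key i j k l hp, ← OmOp_comm_opA, ← OmOp_comm_opA, hUm, sub_self]
  rw [hOm] at h0
  have h1 := hsol.1 _ h0 (i, j, k, l)
  simp only [dd, if_pos hp, LinearMap.comp_apply, map_sub, opA_sq] at h1
  obtain ⟨g1, g2, g3, g4, g5, g6⟩ := hp
  rw [← opA_comm T g3 g4 g5 g6, opA_sq, opA_sq, map_smul, opA_comm T g3 g4 g5 g6, h.two,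
    map_smul, map_smul, smul_smul, smul_smul, ← smul_sub] at h1
  have h2 := (smul_eq_zero.1 h1).resolve_left (by norm_num)
  exact sub_eq_zero.1 h2
end AbstractPart2

end PartA2

section PartC
set_option linter.unusedSectionVars false

/-- index of the permanent with possibly unsorted rows and columns -/
def wIdx {m n : ℕ} (i i' : Fin m) (s s' : Fin n) : PermIdx m n :=
  ⟨((min i i', max i i'), (min s s', max s s')), min_le_max, min_le_max⟩

lemma wIdx_row {m n : ℕ} (i i' : Fin m) (s s' : Fin n) : wIdx i i' s s' = wIdx i' i s s' := by
  exact Subtype.ext (by simp [wIdx, min_comm i i', max_comm i i'])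

lemma wIdx_col {m n : ℕ} (i i' : Fin m) (s s' : Fin n) : wIdx i i' s s' = wIdx i i' s' s := by
  exact Subtype.ext (by simp [wIdx, min_comm s s', max_comm s s'])

lemma wIdx_self {m n : ℕ} (w : PermIdx m n) : wIdx w.1.1.1 w.1.1.2 w.1.2.1 w.1.2.2 = w := by
  obtain ⟨⟨⟨a, b⟩, ⟨c, d⟩⟩, h1, h2⟩ := w
  simp only at h1 h2
  exact Subtype.ext (by simp [wIdx, h1, h2])

lemma perm_wIdx {m n : ℕ} (i i' : Fin m) (s s' : Fin n) :
    perm (wIdx i i' s s') = X (i, s) * X (i', s') + X (i, s') * X (i', s) := by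
  rcases le_total i i' with h | h <;> rcases le_total s s' with h' | h' <;>
    simp [perm, wIdx, h, h'] <;> ring

section
variable {ι : Type*} [Fintype ι] [DecidableEq ι] {m n : ℕ}

/-- listed monomial over a set of positions -/
noncomputable def mon (a : ι → Fin m) (s : ι → Fin n) (t : Finset ι) :
    MvPolynomial (Fin m × Fin n) ℂ := ∏ l ∈ t, X (a l, s l)

lemma exists_relist {β : Type*} [DecidableEq β] (z z' : ι → β)
    (h : ∑ l, Finsupp.single (z l) 1 = ∑ l, Finsupp.single (z' l) (1 : ℕ)) :
    ∃ g : Equiv.Perm ι, ∀ l, z' (g l) = z l := by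
  have hc : ∀ y, Nonempty ({l // z l = y} ≃ {l // z' l = y}) := by
    intro y
    refine ⟨Fintype.equivOfCardEq ?_⟩
    have := DFunLike.congr_fun h y
    simp only [Finsupp.finsetSum_apply, Finsupp.single_apply, Finset.sum_boole] at this
    rw [Fintype.card_subtype, Fintype.card_subtype]
    exact_mod_cast this
  exact ⟨Equiv.ofFiberEquiv fun y => (hc y).some, fun l => Equiv.ofFiberEquiv_map _ l⟩

lemma mon_univ (a : ι → Fin m) (s : ι → Fin n) :
    mon a s Finset.univ = monomial (∑ l, Finsupp.single (a l, s l) 1) 1 := by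
  simp [mon, monomial_sum_one, X]

lemma exists_Phi (N : (ι → Fin m) → (ι → Fin n) → ℂ)
    (hN : ∀ (g : Equiv.Perm ι) a s, N (a ∘ g) (s ∘ g) = N a s) :
    ∃ Φ : MvPolynomial (Fin m × Fin n) ℂ →ₗ[ℂ] ℂ, ∀ a s, Φ (mon a s Finset.univ) = N a s := by
  classical
  let f : ((Fin m × Fin n) →₀ ℕ) → ℂ := fun α =>
    if h : ∃ z : ι → Fin m × Fin n, ∑ l, Finsupp.single (z l) 1 = α then
      N (fun l => (h.choose l).1) (fun l => (h.choose l).2) else 0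
  refine ⟨(basisMonomials (Fin m × Fin n) ℂ).constr ℂ f, fun a s => ?_⟩
  have h : ∃ z : ι → Fin m × Fin n, ∑ l, Finsupp.single (z l) 1 =
    ∑ l, Finsupp.single (a l, s l) 1 := ⟨_, rfl⟩
  have h1 : mon a s Finset.univ =
      (basisMonomials (Fin m × Fin n) ℂ) (∑ l, Finsupp.single (a l, s l) 1) := by
    rw [mon_univ]; simp
  rw [h1, Module.Basis.constr_basis]
  simp only [f]
  rw [dif_pos h]
  obtain ⟨g, hg⟩ := exists_relist _ _ h.choose_spec
  rw [← hN g a s]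
  congr 1 <;> ext l <;> simp [← hg l]

open Equiv in
/-- the sign-twisted column action -/
noncomputable def colT (ι : Type*) [Fintype ι] [DecidableEq ι] (m n : ℕ) :
    Perm ι →* (EuclideanSpace ℂ ((ι → Fin m) × (ι → Fin n)) →ₗ[ℂ]
      EuclideanSpace ℂ ((ι → Fin m) × (ι → Fin n))) where
  toFun g :=
    { toFun := fun f => WithLp.toLp 2 fun z => ((Perm.sign g : ℤ) : ℂ) * f (z.1, z.2 ∘ g)
      map_add' := by intro x y; ext z; simp [mul_add]
      map_smul' := by intro r x; ext z; simp; ring }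
  map_one' := by ext f z; simp
  map_mul' g h := by
    ext f z
    simp only [LinearMap.coe_mk, AddHom.coe_mk, Module.End.mul_apply, Perm.sign_mul, Perm.coe_mul,
      Function.comp_assoc]
    push_cast
    ring

lemma colT_apply (g : Equiv.Perm ι) (f : EuclideanSpace ℂ ((ι → Fin m) × (ι → Fin n)))
    (a : ι → Fin m) (s : ι → Fin n) :
    colT ι m n g f (a, s) = ((Equiv.Perm.sign g : ℤ) : ℂ) * f (a, s ∘ g) := rfl

lemma colT_inner (g : Equiv.Perm ι) (x y : EuclideanSpace ℂ ((ι → Fin m) × (ι → Fin n))) :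
    inner ℂ (colT ι m n g x) (colT ι m n g y) = inner ℂ x y := by
  simp only [PiLp.inner_apply]
  let e : ((ι → Fin m) × (ι → Fin n)) ≃ ((ι → Fin m) × (ι → Fin n)) :=
    (Equiv.refl _).prodCongr (Equiv.arrowCongr g.symm (Equiv.refl _))
  refine Fintype.sum_equiv e _ _ fun z => ?_
  obtain ⟨a, s⟩ := z
  have he : e (a, s) = (a, s ∘ g) := by
    simp [e]; rfl
  rw [colT_apply, colT_apply, he]
  rcases Int.units_eq_one_or (Equiv.Perm.sign g) with h | h <;> simp [h]

lemma opA_colT {i j : ι} (hij : i ≠ j) (f : EuclideanSpace ℂ ((ι → Fin m) × (ι → Fin n)))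
    (a : ι → Fin m) (s : ι → Fin n) :
    opA (colT ι m n) i j f (a, s) = f (a, s) + f (a, s ∘ Equiv.swap i j) := by
  rw [opA_apply]
  change f (a, s) - colT ι m n (Equiv.swap i j) f (a, s) = _
  rw [colT_apply, Equiv.Perm.sign_swap hij]; simp

/-- the cocycle attached to a functional -/
noncomputable def mcoc (φ : (PermIdx m n → MvPolynomial (Fin m × Fin n) ℂ) →ₗ[ℂ] ℂ) (i j : ι) :
    EuclideanSpace ℂ ((ι → Fin m) × (ι → Fin n)) :=
  WithLp.toLp 2 fun z => if i = j then 0 else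
    φ (Pi.single (wIdx (z.1 i) (z.1 j) (z.2 i) (z.2 j)) (mon z.1 z.2 (Finset.univ \ {i, j})))

lemma mcoc_apply (φ : (PermIdx m n → MvPolynomial (Fin m × Fin n) ℂ) →ₗ[ℂ] ℂ) {i j : ι}
    (hij : i ≠ j) (a : ι → Fin m) (s : ι → Fin n) :
    mcoc φ i j (a, s) =
    φ (Pi.single (wIdx (a i) (a j) (s i) (s j)) (mon a s (Finset.univ \ {i, j}))) := by
  simp [mcoc, hij]

lemma mcoc_swap (φ : (PermIdx m n → MvPolynomial (Fin m × Fin n) ℂ) →ₗ[ℂ] ℂ) {i j k l : ι}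
    (hp : Dist4 i j k l) (a : ι → Fin m) (s : ι → Fin n) :
    opA (colT ι m n) k l (mcoc φ i j) (a, s) =
      φ (Pi.single (wIdx (a i) (a j) (s i) (s j)) (perm (wIdx (a k) (a l) (s k) (s l)) *
        mon a s (Finset.univ \ {i, j, k, l}))) := by
  obtain ⟨h1, h2, h3, h4, h5, h6⟩ := hp
  rw [opA_colT h2, mcoc_apply φ h1, mcoc_apply φ h1]
  have hi : Equiv.swap k l i = i := Equiv.swap_apply_of_ne_of_ne h3 h4
  have hj : Equiv.swap k l j = j := Equiv.swap_apply_of_ne_of_ne h5 h6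
  simp only [Function.comp, hi, hj]
  rw [← map_add, ← Pi.single_add]
  congr 2
  have hset : Finset.univ \ {i, j} = insert k (insert l (Finset.univ \ ({i, j, k, l} : Finset ι))) := by
    ext x
    simp only [Finset.mem_sdiff, Finset.mem_univ, true_and, Finset.mem_insert,
      Finset.mem_singleton]
    by_cases hk : x = k
    · subst hk; simp [h3.symm, h5.symm]
    by_cases hl : x = l
    · subst hl; simp [h4.symm, h6.symm]
    simp [hk, hl]
  have hk' : k ∉ insert l (Finset.univ \ ({i, j, k, l} : Finset ι)) := by simp [h2]
  have hl' : l ∉ (Finset.univ \ ({i, j, k, l} : Finset ι)) := by simp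
  have hmon : ∏ x ∈ Finset.univ \ ({i, j, k, l} : Finset ι),
      (X (a x, s (Equiv.swap k l x)) : MvPolynomial (Fin m × Fin n) ℂ) =
      ∏ x ∈ Finset.univ \ ({i, j, k, l} : Finset ι), X (a x, s x) := by
    refine Finset.prod_congr rfl fun x hx => ?_
    simp only [Finset.mem_sdiff, Finset.mem_univ, true_and, Finset.mem_insert,
      Finset.mem_singleton, not_or] at hx
    rw [Equiv.swap_apply_of_ne_of_ne hx.2.2.1 hx.2.2.2]
  rw [perm_wIdx, mon, mon, mon, hset, Finset.prod_insert hk', Finset.prod_insert hl',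
    Finset.prod_insert hk', Finset.prod_insert hl']
  simp only [Function.comp_apply]
  rw [hmon, Equiv.swap_apply_left,
    Equiv.swap_apply_right]
  ring

lemma mcoc_isCoc (φ : (PermIdx m n → MvPolynomial (Fin m × Fin n) ℂ) →ₗ[ℂ] ℂ)
    (hφ : ∀ k ∈ KosModBar m n, φ k = 0) : IsCoc (colT ι m n) (mcoc φ) := by
  refine ⟨?_, ?_, ?_, ?_⟩
  · intro i; ext z; simp [mcoc]
  · intro i j
    ext ⟨a, s⟩
    by_cases hij : i = j
    · subst hij; rfl
    · rw [mcoc_apply φ hij, mcoc_apply φ (Ne.symm hij), wIdx_row, wIdx_col, Finset.pair_comm]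
  · intro i j hij
    ext ⟨a, s⟩
    rw [colT_apply, Equiv.Perm.sign_swap hij, mcoc_apply φ hij, PiLp.neg_apply, mcoc_apply φ hij]
    have hmon : mon a (s ∘ Equiv.swap i j) (Finset.univ \ {i, j}) =
        mon a s (Finset.univ \ {i, j}) := by
      refine Finset.prod_congr rfl fun x hx => ?_
      simp only [Finset.mem_sdiff, Finset.mem_univ, true_and, Finset.mem_insert,
        Finset.mem_singleton, not_or] at hx
      rw [Function.comp, Equiv.swap_apply_of_ne_of_ne hx.1 hx.2]
    rw [hmon, wIdx_col]
    simp
  · intro i j k l h1 h2 h3 h4 h5 h6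
    ext ⟨a, s⟩
    have hp : Dist4 i j k l := ⟨h1, h2, h3, h4, h5, h6⟩
    have hp' : Dist4 k l i j := ⟨h2, h1, h3.symm, h5.symm, h4.symm, h6.symm⟩
    have hset : ({k, l, i, j} : Finset ι) = {i, j, k, l} := by
      ext x; simp only [Finset.mem_insert, Finset.mem_singleton]; tauto
    rw [mcoc_swap φ hp, mcoc_swap φ hp', hset, ← sub_eq_zero, ← map_sub]
    apply hφ
    have := (KosModBar m n).smul_mem (mon a s (Finset.univ \ {i, j, k, l}))
      (Submodule.subset_span ⟨wIdx (a i) (a j) (s i) (s j), wIdx (a k) (a l) (s k) (s l), rfl⟩)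
    convert this using 1
    rw [smul_sub, ← Pi.single_smul, ← Pi.single_smul, smul_eq_mul, smul_eq_mul, mul_comm, mul_comm (perm _)]

lemma exists_Phi_main (hcard : 5 ≤ Fintype.card ι)
    (φ : (PermIdx m n → MvPolynomial (Fin m × Fin n) ℂ) →ₗ[ℂ] ℂ)
    (hφ : ∀ k ∈ KosModBar m n, φ k = 0) :
    ∃ Φ : MvPolynomial (Fin m × Fin n) ℂ →ₗ[ℂ] ℂ, ∀ (i j k l : ι), Dist4 i j k l →
      ∀ (a : ι → Fin m) (s : ι → Fin n),
      φ (Pi.single (wIdx (a i) (a j) (s i) (s j)) (perm (wIdx (a k) (a l) (s k) (s l)) *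
        mon a s (Finset.univ \ {i, j, k, l}))) =
      Φ (perm (wIdx (a i) (a j) (s i) (s j)) * (perm (wIdx (a k) (a l) (s k) (s l)) *
        mon a s (Finset.univ \ {i, j, k, l}))) := by
  obtain ⟨m0, hm0⟩ := (mcoc_isCoc (ι := ι) φ hφ).main hcard colT_inner
  let N : (ι → Fin m) → (ι → Fin n) → ℂ := fun a s => ∑ g : Equiv.Perm ι, m0 (a ∘ g, s ∘ g)
  obtain ⟨Φ, hΦ⟩ := exists_Phi N (fun h a s => by
    refine Fintype.sum_equiv (Equiv.mulLeft h) _ _ fun g => ?_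
    simp [Function.comp_assoc])
  have hfac : (Fintype.card (Equiv.Perm ι) : ℂ) ≠ 0 := by
    exact_mod_cast Fintype.card_ne_zero
  refine ⟨(Fintype.card (Equiv.Perm ι) : ℂ)⁻¹ • Φ, fun i j k l hp a s => ?_⟩
  have hL : ∀ g : Equiv.Perm ι, φ (Pi.single (wIdx (a i) (a j) (s i) (s j))
      (perm (wIdx (a k) (a l) (s k) (s l)) * mon a s (Finset.univ \ {i, j, k, l}))) =
      m0 (a ∘ g, s ∘ g) + m0 (a ∘ g, (s ∘ Equiv.swap k l) ∘ g) + (m0 (a ∘ g, (s ∘ Equiv.swap i j) ∘ g) +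
        m0 (a ∘ g, (s ∘ Equiv.swap i j ∘ Equiv.swap k l) ∘ g)) := by
    intro g
    have hp' : Dist4 (g.symm i) (g.symm j) (g.symm k) (g.symm l) := by simpa [Dist4] using hp
    have h1 := congrFun (congrArg (fun f => f.ofLp) (hm0 _ _ _ _ hp')) (a ∘ g, s ∘ g)
    simp only at h1
    rw [mcoc_swap φ hp'] at h1
    obtain ⟨p1, p2, p3, p4, p5, p6⟩ := hp'
    rw [opA_colT p1, opA_colT p2, opA_colT p2] at h1
    have hsw : ∀ x y : ι, g ∘ Equiv.swap (g.symm x) (g.symm y) = Equiv.swap x y ∘ g := by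
      intro x y; ext t
      simp [Equiv.swap_apply_def, Equiv.eq_symm_apply]
      split_ifs <;> simp_all
    have hmon : mon (a ∘ g) (s ∘ g) (Finset.univ \ {g.symm i, g.symm j, g.symm k, g.symm l}) =
        mon a s (Finset.univ \ {i, j, k, l}) := by
      refine Finset.prod_equiv g ?_ (fun _ _ => rfl)
      intro x
      simp [Equiv.eq_symm_apply]
    rw [hmon] at h1
    simp only [Function.comp_apply, Equiv.apply_symm_apply] at h1
    rw [h1]
    simp only [Function.comp_assoc, hsw]
  have hexp : perm (wIdx (a i) (a j) (s i) (s j)) * (perm (wIdx (a k) (a l) (s k) (s l)) *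
        mon a s (Finset.univ \ {i, j, k, l})) = mon a s Finset.univ +
        mon a (s ∘ Equiv.swap k l) Finset.univ + (mon a (s ∘ Equiv.swap i j) Finset.univ +
        mon a (s ∘ Equiv.swap i j ∘ Equiv.swap k l) Finset.univ) := by
    have hp' := hp
    obtain ⟨h1, h2, h3, h4, h5, h6⟩ := hp
    have hmon : ∀ s' : ι → Fin n, (∀ x, x ∉ ({i, j, k, l} : Finset ι) → s' x = s x) →
        mon a s' Finset.univ = X (a i, s' i) * X (a j, s' j) * X (a k, s' k) * X (a l, s' l) *
          mon a s (Finset.univ \ {i, j, k, l}) := by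
      intro s' hs'
      have : mon a s (Finset.univ \ {i, j, k, l}) = mon a s' (Finset.univ \ {i, j, k, l}) :=
        Finset.prod_congr rfl fun x hx => by rw [hs' x (Finset.mem_sdiff.1 hx).2]
      rw [this, mon, mon, ← Finset.prod_sdiff (Finset.subset_univ {i, j, k, l}),
        Finset.prod_insert (by simp [*]), Finset.prod_insert (by simp [*]),
        Finset.prod_insert (by simp [*]), Finset.prod_singleton]
      ring
    have q : ∀ x y z : ι, z ≠ x → z ≠ y → Equiv.swap x y z = z :=
      fun x y z => Equiv.swap_apply_of_ne_of_ne
    rw [hmon s (fun _ _ => rfl), hmon (s ∘ Equiv.swap k l), hmon (s ∘ Equiv.swap i j),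
      hmon (s ∘ Equiv.swap i j ∘ Equiv.swap k l)]
    · simp only [Function.comp_apply, Equiv.swap_apply_left, Equiv.swap_apply_right,
        q k l i h3 h4, q k l j h5 h6, q i j k h3.symm h5.symm, q i j l h4.symm h6.symm, perm_wIdx]
      ring
    all_goals
      intro x hx
      simp only [Finset.mem_insert, Finset.mem_singleton, not_or] at hx
      obtain ⟨x1, x2, x3, x4⟩ := hx
      simp only [Function.comp_apply, q k l x x3 x4, q i j x x1 x2]
  rw [hexp]
  simp only [map_add, LinearMap.smul_apply, hΦ, N, smul_eq_mul]
  rw [← mul_add, ← mul_add, ← mul_add, ← Finset.sum_add_distrib, ← Finset.sum_add_distrib,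
    ← Finset.sum_add_distrib, ← Finset.sum_congr rfl (fun g _ => hL g), Finset.sum_const,
    Finset.card_univ, nsmul_eq_mul, inv_mul_cancel_left₀ hfac]
end

/-- degree `e + 2` part of the ideal of permanents -/
noncomputable def IL (m n e : ℕ) : Submodule ℂ (MvPolynomial (Fin m × Fin n) ℂ) :=
  Submodule.span ℂ (Set.range fun q : PermIdx m n × (Fin e → Fin m) × (Fin e → Fin n) =>
    perm q.1 * mon q.2.1 q.2.2 Finset.univ)

theorem syz_mem_kos {m n e : ℕ} (he : 1 ≤ e) (v : PermIdx m n → MvPolynomial (Fin m × Fin n) ℂ)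
    (hv : ∀ w, v w ∈ IL m n e) (hsyz : ∑ w, v w * perm w = 0) : v ∈ KosModBar m n := by
  by_contra hcon
  obtain ⟨φ, hφv, hφ⟩ := Submodule.exists_le_ker_of_notMem
    (p := (KosModBar m n).restrictScalars ℂ) (v := v) (by simpa using hcon)
  obtain ⟨Φ, hΦ⟩ := exists_Phi_main (ι := Fin 4 ⊕ Fin e) (by simp; omega) φ
    (fun k hk => by simpa using hφ hk)
  have key : ∀ w, ∀ f ∈ IL m n e, φ (Pi.single w f) = Φ (perm w * f) := by
    intro w f hf
    induction hf using Submodule.span_induction with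
    | zero => simp
    | add x y _ _ hx hy => rw [Pi.single_add, map_add, hx, hy, mul_add, map_add]
    | smul r x _ hx => rw [Pi.single_smul, map_smul, hx, mul_smul_comm, map_smul]
    | mem x hx =>
      obtain ⟨⟨w', a, s⟩, rfl⟩ := hx
      let a' : Fin 4 ⊕ Fin e → Fin m :=
        Sum.elim ![w.1.1.1, w.1.1.2, w'.1.1.1, w'.1.1.2] a
      let s' : Fin 4 ⊕ Fin e → Fin n :=
        Sum.elim ![w.1.2.1, w.1.2.2, w'.1.2.1, w'.1.2.2] s
      have h := hΦ (Sum.inl 0) (Sum.inl 1) (Sum.inl 2) (Sum.inl 3) (by simp [Dist4]) a' s'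
      have hmon : mon a' s' (Finset.univ \ {Sum.inl 0, Sum.inl 1, Sum.inl 2, Sum.inl 3}) =
          mon a s Finset.univ := by
        have : (Finset.univ \ {Sum.inl 0, Sum.inl 1, Sum.inl 2, Sum.inl 3} :
            Finset (Fin 4 ⊕ Fin e)) = Finset.univ.map Function.Embedding.inr := by
          ext x
          rcases x with x | x
          · fin_cases x <;> simp
          · simp
        rw [mon, this, Finset.prod_map]; rfl
      rw [hmon] at h
      simp only [a', s', Sum.elim_inl, Matrix.cons_val_zero, Matrix.cons_val_one,
        Matrix.cons_val] at h
      rw [wIdx_self, wIdx_self] at h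
      exact h
  apply hφv
  have : v = ∑ w, Pi.single w (v w) := by
    exact (Finset.univ_sum_single v).symm
  rw [this, map_sum]
  simp only [key _ _ (hv _), ← map_sum]
  simp only [mul_comm (perm _), hsyz, map_zero]

end PartC

section PartD
set_option linter.unusedSectionVars false

/-- exterior powers of `ℂ^m` -/
def LL (m k : ℕ) : Type := ↥(⋀[ℂ]^k (Fin m → ℂ))

noncomputable instance LL.instAddCommGroup (m k : ℕ) : AddCommGroup (LL m k) :=
  inferInstanceAs (AddCommGroup ↥(⋀[ℂ]^k (Fin m → ℂ)))

noncomputable instance LL.instModule (m k : ℕ) : Module ℂ (LL m k) :=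
  inferInstanceAs (Module ℂ ↥(⋀[ℂ]^k (Fin m → ℂ)))

instance LL.instFinite (m k : ℕ) : Module.Finite ℂ (LL m k) :=
  inferInstanceAs (Module.Finite ℂ ↥(⋀[ℂ]^k (Fin m → ℂ)))

/-- the universal alternating map -/
noncomputable def iM (m k : ℕ) : (Fin m → ℂ) [⋀^Fin k]→ₗ[ℂ] LL m k :=
  exteriorPower.ιMulti ℂ k

/-- lift of alternating maps -/
noncomputable def llLift {m k : ℕ} {M : Type*} [AddCommGroup M] [Module ℂ M]
    (f : (Fin m → ℂ) [⋀^Fin k]→ₗ[ℂ] M) : LL m k →ₗ[ℂ] M :=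
  exteriorPower.alternatingMapLinearEquiv f

lemma llLift_iM {m k : ℕ} {M : Type*} [AddCommGroup M] [Module ℂ M]
    (f : (Fin m → ℂ) [⋀^Fin k]→ₗ[ℂ] M) (v : Fin k → Fin m → ℂ) : llLift f (iM m k v) = f v :=
  exteriorPower.alternatingMapLinearEquiv_apply_ιMulti f v

lemma LL_finrank (m k : ℕ) : Module.finrank ℂ (LL m k) = m.choose k := by
  have := exteriorPower.finrank_eq (R := ℂ) (M := Fin m → ℂ) k
  rw [Module.finrank_fin_fun] at this
  exact this


/-- wedge of basis vectors -/
noncomputable def ew {m k : ℕ} (a : Fin k → Fin m) : LL m k :=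
  iM m k (fun i => (Pi.single (a i) 1 : Fin m → ℂ))

section
variable {m k : ℕ} {M : Type*} [AddCommGroup M] [Module ℂ M]

lemma ew_perm (a : Fin k → Fin m) (g : Equiv.Perm (Fin k)) :
    ew (a ∘ g) = ((Equiv.Perm.sign g : ℤ) : ℂ) • ew a := by
  have := AlternatingMap.map_perm (iM m k)
    (fun i => (Pi.single (a i) 1 : Fin m → ℂ)) g
  rw [Units.smul_def, ← Int.cast_smul_eq_zsmul ℂ] at this
  exact this

lemma ew_span : Submodule.span ℂ (Set.range (ew : (Fin k → Fin m) → LL m k)) = ⊤ := by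
  have hs : Submodule.span ℂ (Set.range fun i : Fin m => (Pi.single i 1 : Fin m → ℂ)) = ⊤ := by
    have := (Pi.basisFun ℂ (Fin m)).span_eq
    convert this using 3
    ext i; simp
  have h0 : Submodule.span ℂ (Set.image (iM m k) {a | Set.range a ⊆
      Set.range fun i : Fin m => (Pi.single i 1 : Fin m → ℂ)}) = ⊤ :=
    exteriorPower.ιMulti_span_of_span ℂ k _ hs
  rw [eq_top_iff, ← h0]
  refine Submodule.span_mono ?_
  rintro x ⟨v, hv, rfl⟩
  have hv' : ∀ i, ∃ j, Pi.single j 1 = (v i : Fin m → ℂ) := fun i => hv ⟨i, rfl⟩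
  choose a ha using hv'
  refine ⟨a, ?_⟩
  unfold ew
  congr 1
  ext1 i
  exact ha i

lemma ll_ext {f g : LL m k →ₗ[ℂ] M} (h : ∀ a, f (ew a) = g (ew a)) : f = g := by
  refine LinearMap.ext_on_range ew_span h

/-- wedge with a basis vector -/
noncomputable def wd (l : Fin m) : LL m k →ₗ[ℂ] LL m (k + 1) :=
  llLift
    ((iM m (k + 1)).curryLeft (Pi.single l 1 : Fin m → ℂ))

lemma wd_ew (l : Fin m) (a : Fin k → Fin m) : wd l (ew a) = ew (Fin.cons l a : Fin (k + 1) → Fin m) := by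
  rw [wd, ew, llLift_iM,
    AlternatingMap.curryLeft_apply_apply, ew]
  congr 1
  ext i
  refine Fin.cases ?_ (fun j => ?_) i <;> simp

/-- contraction with a family -/
noncomputable def contr (φ : Fin m → LL m k →ₗ[ℂ] M) : LL m (k + 1) →ₗ[ℂ] M :=
  llLift (AlternatingMap.alternatizeUncurryFin
    ((Pi.basisFun ℂ (Fin m)).constr ℂ
      fun l => (φ l).compAlternatingMap (iM m k)))

lemma contr_ew (φ : Fin m → LL m k →ₗ[ℂ] M) (b : Fin (k + 1) → Fin m) :
    contr φ (ew b) = ∑ p : Fin (k + 1), (-1 : ℂ) ^ (p : ℕ) • φ (b p) (ew (p.removeNth b)) := by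
  rw [contr, ew, llLift_iM,
    AlternatingMap.alternatizeUncurryFin_apply]
  refine Finset.sum_congr rfl fun p _ => ?_
  have h1 : (Pi.single (b p) 1 : Fin m → ℂ) = Pi.basisFun ℂ (Fin m) (b p) := by simp
  rw [h1, Module.Basis.constr_basis]
  rw [← Int.cast_smul_eq_zsmul ℂ]
  push_cast
  rfl

lemma ew_cons_remove (b : Fin (k + 1) → Fin m) (p : Fin (k + 1)) :
    ew (Fin.cons (b p) (p.removeNth b) : Fin (k + 1) → Fin m) = (-1 : ℂ) ^ (p : ℕ) • ew b := by
  have := AlternatingMap.map_insertNth (iM m (k + 1)) p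
    (Pi.single (b p) 1 : Fin m → ℂ) (fun i => Pi.single (p.removeNth b i) 1)
  have h1 : (p.insertNth (Pi.single (b p) 1 : Fin m → ℂ) fun i => Pi.single (p.removeNth b i) 1) =
      fun i => (Pi.single (b i) 1 : Fin m → ℂ) := by
    exact Fin.insertNth_self_removeNth p (fun i => (Pi.single (b i) 1 : Fin m → ℂ))
  have h2 : Matrix.vecCons (Pi.single (b p) 1 : Fin m → ℂ) (fun i => Pi.single (p.removeNth b i) 1) =
      fun i => Pi.single ((Fin.cons (b p) (p.removeNth b) : Fin (k + 1) → Fin m) i) 1 := by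
    ext i
    refine Fin.cases ?_ (fun j => ?_) i <;> simp
  rw [h1, h2, ← Int.cast_smul_eq_zsmul ℂ] at this
  push_cast at this
  change ew b = _ • ew _ at this
  rw [this, smul_smul, ← pow_add, Even.neg_one_pow ⟨_, rfl⟩, one_smul]

lemma ew_cons_cons (x y : Fin m) (b : Fin k → Fin m) :
    ew (Fin.cons x (Fin.cons y b : Fin (k + 1) → Fin m) : Fin (k + 2) → Fin m) =
      - ew (Fin.cons y (Fin.cons x b : Fin (k + 1) → Fin m) : Fin (k + 2) → Fin m) := by
  have := ew_cons_remove (Fin.cons y (Fin.cons x b : Fin (k + 1) → Fin m) : Fin (k + 2) → Fin m) 1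
  have h2 : (Fin.removeNth 1 (Fin.cons y (Fin.cons x b : Fin (k + 1) → Fin m) : Fin (k + 2) → Fin m))
      = (Fin.cons y b : Fin (k + 1) → Fin m) := by
    ext1 i
    refine Fin.cases ?_ (fun j => ?_) i <;> simp [Fin.removeNth]
  rw [h2] at this
  have h3 : ((-1 : ℂ) ^ ((1 : Fin (k+2)) : ℕ)) = -1 := by simp
  rw [h3] at this
  exact this.trans (neg_one_smul ℂ _)
end

end PartD

section PartE
set_option linter.unusedSectionVars false

section
variable {m n k : ℕ} {M : Type*} [AddCommGroup M] [Module ℂ M]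

lemma exists_ext (N : (Fin k → Fin m) → M)
    (hN : ∀ (g : Equiv.Perm (Fin k)) a, N (a ∘ g) = ((Equiv.Perm.sign g : ℤ) : ℂ) • N a) :
    ∃ Ψ : LL m k →ₗ[ℂ] M, ∀ a, Ψ (ew a) = N a := by
  classical
  let μ : MultilinearMap ℂ (fun _ : Fin k => Fin m → ℂ) M :=
    ∑ a : Fin k → Fin m, (((MultilinearMap.mkPiAlgebra ℂ (Fin k) ℂ).compLinearMap
      (fun i => LinearMap.proj (a i))).smulRight (N a))
  have hμ : ∀ v, μ v = ∑ a : Fin k → Fin m, (∏ i, v i (a i)) • N a := by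
    intro v; simp [μ]
  let f : (Fin m → ℂ) [⋀^Fin k]→ₗ[ℂ] M :=
    { μ with
      map_eq_zero_of_eq' := by
        intro v i j hv hij
        change μ v = 0
        have h1 : μ v = - μ v := by
          rw [hμ, ← Finset.sum_neg_distrib]
          let e : (Fin k → Fin m) ≃ (Fin k → Fin m) :=
            Equiv.arrowCongr (Equiv.swap i j) (Equiv.refl _)
          refine Fintype.sum_equiv e _ _ fun a => ?_
          have he : e a = a ∘ Equiv.swap i j := by
            ext1 x; simp [e, Equiv.arrowCongr]
          rw [he, hN, Equiv.Perm.sign_swap hij]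
          have : ∏ l, v l ((a ∘ Equiv.swap i j) l) = ∏ l, v l (a l) := by
            refine Fintype.prod_equiv (Equiv.swap i j) _ _ fun l => ?_
            have : v (Equiv.swap i j l) = v l := by
              rcases eq_or_ne l i with rfl | h
              · rw [Equiv.swap_apply_left, hv]
              rcases eq_or_ne l j with rfl | h'
              · rw [Equiv.swap_apply_right, hv]
              rw [Equiv.swap_apply_of_ne_of_ne h h']
            rw [this]; rfl
          rw [this]; simp
        have h2 : (2 : ℂ) • μ v = 0 := by
          rw [two_smul]; nth_rewrite 1 [h1]; simp
        exact (smul_eq_zero.1 h2).resolve_left two_ne_zero }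
  refine ⟨llLift f, fun a => ?_⟩
  rw [ew, llLift_iM]
  change μ _ = _
  rw [hμ, Finset.sum_eq_single a]
  · simp
  · intro b _ hb
    obtain ⟨i, hi⟩ := Function.ne_iff.1 hb
    rw [Finset.prod_eq_zero (Finset.mem_univ i) (by simp [hi]), zero_smul]
  · simp

lemma exists_PhiM {ι : Type*} [Fintype ι] [DecidableEq ι] (N : (ι → Fin m) → (ι → Fin n) → M)
    (hN : ∀ (g : Equiv.Perm ι) a s, N (a ∘ g) (s ∘ g) = N a s) :
    ∃ Φ : MvPolynomial (Fin m × Fin n) ℂ →ₗ[ℂ] M, ∀ a s, Φ (mon a s Finset.univ) = N a s := by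
  classical
  let f : ((Fin m × Fin n) →₀ ℕ) → M := fun α =>
    if h : ∃ z : ι → Fin m × Fin n, ∑ l, Finsupp.single (z l) 1 = α then
      N (fun l => (h.choose l).1) (fun l => (h.choose l).2) else 0
  refine ⟨(basisMonomials (Fin m × Fin n) ℂ).constr ℂ f, fun a s => ?_⟩
  have h : ∃ z : ι → Fin m × Fin n, ∑ l, Finsupp.single (z l) 1 =
    ∑ l, Finsupp.single (a l, s l) 1 := ⟨_, rfl⟩
  have h1 : mon a s Finset.univ =
      (basisMonomials (Fin m × Fin n) ℂ) (∑ l, Finsupp.single (a l, s l) 1) := by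
    rw [mon_univ]; simp
  rw [h1, Module.Basis.constr_basis]
  simp only [f]
  rw [dif_pos h]
  obtain ⟨g, hg⟩ := exists_relist _ _ h.choose_spec
  rw [← hN g a s]
  congr 1 <;> ext l <;> simp [← hg l]

open TensorProduct in
lemma exists_rho (m n k : ℕ) : ∃ Φ : MvPolynomial (Fin m × Fin n) ℂ →ₗ[ℂ] LL m k ⊗[ℂ] LL n k,
    ∀ (a : Fin k → Fin m) (s : Fin k → Fin n), Φ (mon a s Finset.univ) = ew a ⊗ₜ ew s := by
  refine exists_PhiM (fun a s => ew a ⊗ₜ ew s) fun g a s => ?_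
  rw [ew_perm, ew_perm, TensorProduct.smul_tmul_smul]
  rcases Int.units_eq_one_or (Equiv.Perm.sign g) with h | h <;> simp [h]

open TensorProduct in
/-- projection to the product of exterior powers -/
noncomputable def rho (m n k : ℕ) : MvPolynomial (Fin m × Fin n) ℂ →ₗ[ℂ] LL m k ⊗[ℂ] LL n k :=
  (exists_rho m n k).choose

open TensorProduct in
lemma rho_mon (a : Fin k → Fin m) (s : Fin k → Fin n) :
    rho m n k (mon a s Finset.univ) = ew a ⊗ₜ ew s := (exists_rho m n k).choose_spec a s

/-- span of listed monomials -/
noncomputable def Hm (m n k : ℕ) : Submodule ℂ (MvPolynomial (Fin m × Fin n) ℂ) :=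
  Submodule.span ℂ (Set.range fun q : (Fin k → Fin m) × (Fin k → Fin n) => mon q.1 q.2 Finset.univ)

lemma mon_isHomogeneous {ι : Type*} [Fintype ι] [DecidableEq ι] (a : ι → Fin m) (s : ι → Fin n)
    (t : Finset ι) : (mon a s t).IsHomogeneous t.card := by
  have := IsHomogeneous.prod t (fun l => (X (a l, s l) : MvPolynomial (Fin m × Fin n) ℂ))
    (fun _ => 1) (fun i _ => isHomogeneous_X _ _)
  simpa [mon] using this

lemma Hm_eq (m n k : ℕ) : Hm m n k = homogeneousSubmodule (Fin m × Fin n) ℂ k := by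
  classical
  apply le_antisymm
  · rw [Hm, Submodule.span_le]
    rintro _ ⟨q, rfl⟩
    have := mon_isHomogeneous q.1 q.2 Finset.univ
    simpa using this
  · intro f hf
    rw [f.as_sum]
    refine Submodule.sum_mem _ fun α hα => ?_
    have hdeg : α.degree = k := by
      have := (mem_homogeneousSubmodule k f).1 hf (mem_support_iff.1 hα)
      rw [← this]
      exact DFunLike.congr_fun Finsupp.degree_eq_weight_one α
    have h1 : (Finsupp.toMultiset α).card = k := by
      rw [Finsupp.card_toMultiset, ← hdeg]; rfl
    obtain ⟨l, hl⟩ := Quot.exists_rep (Finsupp.toMultiset α)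
    have hll : l.length = k := by rw [← h1, ← hl]; rfl
    subst hll
    have h2 : monomial α (coeff α f) = coeff α f • mon (fun i => (l.get i).1)
        (fun i => (l.get i).2) Finset.univ := by
      rw [mon_univ, smul_monomial, smul_eq_mul, mul_one]
      congr 2
      apply Multiset.toFinsupp.symm.injective
      change Finsupp.toMultiset α = Finsupp.toMultiset _
      rw [← hl, map_sum]
      simp only [Prod.mk.eta, Finsupp.toMultiset_single, one_smul]
      have h3 : ∀ l' : List (Fin m × Fin n), (l' : Multiset (Fin m × Fin n)) =
          ∑ i, {l'.get i} := by
        intro l'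
        induction l' with
        | nil => simp
        | cons y l' ih =>
          rw [← Multiset.cons_coe, ih, ← Multiset.singleton_add]
          exact (Fin.sum_univ_succ (n := l'.length) (fun i => {(y :: l').get i})).symm
      exact h3 l
    rw [h2]
    exact Submodule.smul_mem _ _ (Submodule.subset_span ⟨(_, _), rfl⟩)

lemma mon_cons (i : Fin m) (s : Fin n) (a : Fin k → Fin m) (b : Fin k → Fin n) :
    mon (Fin.cons i a : Fin (k + 1) → Fin m) (Fin.cons s b : Fin (k + 1) → Fin n) Finset.univ =
      X (i, s) * mon a b Finset.univ := by
  simp [mon, Fin.prod_univ_succ]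

lemma perm_mul_mon (i i' : Fin m) (s s' : Fin n) (a : Fin k → Fin m) (b : Fin k → Fin n) :
    perm (wIdx i i' s s') * mon a b Finset.univ =
    mon (Fin.cons i (Fin.cons i' a : Fin (k + 1) → Fin m) : Fin (k + 2) → Fin m)
      (Fin.cons s (Fin.cons s' b : Fin (k + 1) → Fin n) : Fin (k + 2) → Fin n) Finset.univ +
    mon (Fin.cons i (Fin.cons i' a : Fin (k + 1) → Fin m) : Fin (k + 2) → Fin m)
      (Fin.cons s' (Fin.cons s b : Fin (k + 1) → Fin n) : Fin (k + 2) → Fin n) Finset.univ := by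
  rw [mon_cons, mon_cons, mon_cons, mon_cons, perm_wIdx]; ring

lemma perm_mul_mem_IL {e : ℕ} (w : PermIdx m n) {f : MvPolynomial (Fin m × Fin n) ℂ}
    (hf : f.IsHomogeneous e) : perm w * f ∈ IL m n e := by
  have h : f ∈ Hm m n e := by rw [Hm_eq]; exact hf
  have h2 : Hm m n e ≤ (IL m n e).comap (LinearMap.mulLeft ℂ (perm w)) := by
    rw [Hm, Submodule.span_le]
    rintro _ ⟨q, rfl⟩
    exact Submodule.subset_span ⟨(w, q.1, q.2), rfl⟩
  exact h2 h

lemma rho_IL {e : ℕ} {f : MvPolynomial (Fin m × Fin n) ℂ} (hf : f ∈ IL m n e) :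
    rho m n (e + 2) f = 0 := by
  induction hf using Submodule.span_induction with
  | mem x hx =>
    obtain ⟨⟨w, a, b⟩, rfl⟩ := hx
    simp only
    rw [← wIdx_self w, perm_mul_mon, map_add, rho_mon, rho_mon, ← TensorProduct.tmul_add,
      ew_cons_cons (m := n), neg_add_cancel, TensorProduct.tmul_zero]
  | zero => simp
  | add x y _ _ hx hy => rw [map_add, hx, hy, add_zero]
  | smul r x _ hx => rw [map_smul, hx, smul_zero]

lemma mon_swap_mem {e : ℕ} (a : Fin (e + 2) → Fin m) (s : Fin (e + 2) → Fin n)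
    {p q : Fin (e + 2)} (hpq : p ≠ q) :
    mon a s Finset.univ + mon a (s ∘ Equiv.swap p q) Finset.univ ∈ IL m n e := by
  have h : ∀ s : Fin (e + 2) → Fin n, mon a s Finset.univ =
      X (a p, s p) * (X (a q, s q) * mon a s ((Finset.univ.erase p).erase q)) := by
    intro s
    rw [mon, mon, Finset.mul_prod_erase _ (fun l => (X (a l, s l) : MvPolynomial (Fin m × Fin n) ℂ))
      (by simp [hpq.symm]), Finset.mul_prod_erase _ (fun l => (X (a l, s l) :
        MvPolynomial (Fin m × Fin n) ℂ)) (by simp)]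
  have h2 : mon a (s ∘ Equiv.swap p q) ((Finset.univ.erase p).erase q) =
      mon a s ((Finset.univ.erase p).erase q) := by
    refine Finset.prod_congr rfl fun l hl => ?_
    simp only [Finset.mem_erase] at hl
    rw [Function.comp, Equiv.swap_apply_of_ne_of_ne hl.2.1 hl.1]
  have h3 : mon a s Finset.univ + mon a (s ∘ Equiv.swap p q) Finset.univ =
      perm (wIdx (a p) (a q) (s p) (s q)) * mon a s ((Finset.univ.erase p).erase q) := by
    rw [h s, h (s ∘ _), h2, perm_wIdx]
    simp only [Function.comp, Equiv.swap_apply_left, Equiv.swap_apply_right]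
    ring
  rw [h3]
  apply perm_mul_mem_IL
  have := mon_isHomogeneous a s ((Finset.univ.erase p).erase q)
  rwa [Finset.card_erase_of_mem (by simp [hpq.symm]), Finset.card_erase_of_mem (by simp),
    Finset.card_univ, Fintype.card_fin] at this

open TensorProduct in
lemma mem_IL_of_rho {e : ℕ} {f : MvPolynomial (Fin m × Fin n) ℂ} (hf : f.IsHomogeneous (e + 2))
    (h0 : rho m n (e + 2) f = 0) : f ∈ IL m n e := by
  classical
  let N : (Fin (e + 2) → Fin m) → (Fin (e + 2) → Fin n) → (_ ⧸ IL m n e) :=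
    fun a s => (IL m n e).mkQ (mon a s Finset.univ)
  have hN1 : ∀ (g : Equiv.Perm (Fin (e + 2))) a s,
      N a (s ∘ g) = ((Equiv.Perm.sign g : ℤ) : ℂ) • N a s := by
    intro g a
    induction g using Equiv.Perm.swap_induction_on with
    | one => intro s; simp
    | swap_mul g x y hxy ih =>
      intro s
      have h1 := ih (s ∘ Equiv.swap x y)
      have h2 : N a s + N a (s ∘ Equiv.swap x y) = 0 := by
        simp only [N]
        rw [← map_add]
        exact (Submodule.Quotient.mk_eq_zero _).2 (mon_swap_mem a s hxy)
      rw [Equiv.Perm.coe_mul, ← Function.comp_assoc, h1, Equiv.Perm.sign_mul,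
        Equiv.Perm.sign_swap hxy, eq_neg_of_add_eq_zero_right h2]
      simp
  have hN0 : ∀ (g : Equiv.Perm (Fin (e + 2))) a s, N (a ∘ g) (s ∘ g) = N a s := by
    intro g a s
    simp only [N]
    congr 1
    exact Fintype.prod_equiv g _ _ fun _ => rfl
  have hN2 : ∀ (g : Equiv.Perm (Fin (e + 2))) a s,
      N (a ∘ g) s = ((Equiv.Perm.sign g : ℤ) : ℂ) • N a s := by
    intro g a s
    have := hN0 g a (s ∘ ⇑(g⁻¹))
    rw [hN1 g⁻¹ a s, Function.comp_assoc, ← Equiv.Perm.coe_mul, inv_mul_cancel] at this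
    simpa using this
  choose Ψ hΨ using fun a => exists_ext (N a) (fun g s => hN1 g a s)
  obtain ⟨Φ, hΦ⟩ := exists_ext (M := LL n (e + 2) →ₗ[ℂ] _) Ψ (fun g a => ll_ext fun s => by
    rw [hΨ, hN2, LinearMap.smul_apply, hΨ])
  have key : ∀ f ∈ Hm m n (e + 2), TensorProduct.lift Φ (rho m n (e + 2) f) = (IL m n e).mkQ f := by
    intro f hf
    induction hf using Submodule.span_induction with
    | mem x hx =>
      obtain ⟨q, rfl⟩ := hx
      rw [rho_mon, TensorProduct.lift.tmul, hΦ, hΨ]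
    | zero => simp
    | add x y _ _ hx hy => rw [map_add, map_add, hx, hy, map_add]
    | smul r x _ hx => rw [map_smul, map_smul, hx, map_smul]
  have := key f (by rw [Hm_eq]; exact hf)
  rw [h0, map_zero] at this
  simpa using this.symm
end

end PartE

section PartF
set_option linter.unusedSectionVars false

/-- pairs tensor exterior power -/
abbrev AA (m k : ℕ) : Type := Sym2 (Fin m) → LL m k
/-- vectors tensor exterior power -/
abbrev BB (m k : ℕ) : Type := Fin m → LL m (k + 1)

section
variable {m k : ℕ} {M : Type*} [AddCommGroup M] [Module ℂ M]

lemma aa_ext {f g : AA m k →ₗ[ℂ] M}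
    (h : ∀ i i' a, f (Pi.single s(i, i') (ew a)) = g (Pi.single s(i, i') (ew a))) : f = g := by
  refine LinearMap.pi_ext' fun p => ll_ext fun a => ?_
  induction p with | _ i i' => exact h i i' a

lemma bb_ext {f g : BB m k →ₗ[ℂ] M}
    (h : ∀ i a, f (Pi.single i (ew a)) = g (Pi.single i (ew a))) : f = g :=
  LinearMap.pi_ext' fun i => ll_ext fun a => h i a

/-- one component of the Koszul type map -/
noncomputable def delC (i i' : Fin m) : LL m k →ₗ[ℂ] BB m k :=
  (LinearMap.single ℂ (fun _ : Fin m => LL m (k + 1)) i) ∘ₗ wd i' +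
    (LinearMap.single ℂ (fun _ : Fin m => LL m (k + 1)) i') ∘ₗ wd i

/-- Koszul type map -/
noncomputable def del (m k : ℕ) : AA m k →ₗ[ℂ] BB m k :=
  LinearMap.lsum ℂ (fun _ : Sym2 (Fin m) => LL m k) ℂ
    (fun p => Sym2.lift ⟨delC, fun i i' => by unfold delC; exact add_comm _ _⟩ p)

lemma del_single (i i' : Fin m) (ω : LL m k) :
    del m k (Pi.single s(i, i') ω) = Pi.single i (wd i' ω) + Pi.single i' (wd i ω) := by
  rw [del, LinearMap.lsum_piSingle]
  rfl

lemma del_single_ew (i i' : Fin m) (a : Fin k → Fin m) :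
    del m k (Pi.single s(i, i') (ew a)) =
      Pi.single i (ew (Fin.cons i' a : Fin (k + 1) → Fin m)) +
      Pi.single i' (ew (Fin.cons i a : Fin (k + 1) → Fin m)) := by
  rw [del_single, wd_ew, wd_ew]

/-- homotopy -/
noncomputable def hh (m k : ℕ) : BB m k →ₗ[ℂ] AA m k :=
  LinearMap.lsum ℂ (fun _ : Fin m => LL m (k + 1)) ℂ
    (fun i => contr fun l => LinearMap.single ℂ (fun _ : Sym2 (Fin m) => LL m k) s(i, l))

lemma hh_single (i : Fin m) (b : Fin (k + 1) → Fin m) :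
    hh m k (Pi.single i (ew b)) = ∑ p : Fin (k + 1), (-1 : ℂ) ^ (p : ℕ) •
      Pi.single s(i, b p) (ew (p.removeNth b)) := by
  rw [hh, LinearMap.lsum_piSingle, contr_ew]
  rfl

/-- last Koszul map -/
noncomputable def del1 (m k : ℕ) : BB m k →ₗ[ℂ] LL m (k + 2) :=
  LinearMap.lsum ℂ (fun _ : Fin m => LL m (k + 1)) ℂ (fun i => wd i)

lemma del1_single (i : Fin m) (b : Fin (k + 1) → Fin m) :
    del1 m k (Pi.single i (ew b)) = ew (Fin.cons i b : Fin (k + 2) → Fin m) := by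
  rw [del1, LinearMap.lsum_piSingle, wd_ew]

/-- last homotopy -/
noncomputable def hh1 (m k : ℕ) : LL m (k + 2) →ₗ[ℂ] BB m k :=
  contr fun l => LinearMap.single ℂ (fun _ : Fin m => LL m (k + 1)) l

lemma hh1_ew (b : Fin (k + 2) → Fin m) : hh1 m k (ew b) = ∑ p : Fin (k + 2), (-1 : ℂ) ^ (p : ℕ) •
      (Pi.single (b p) (ew (p.removeNth b)) : BB m k) := by
  rw [hh1, contr_ew]
  rfl

lemma removeNth_succ_cons (i : Fin m) (b : Fin (k + 1) → Fin m) (p : Fin (k + 1)) :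
    p.succ.removeNth (Fin.cons i b : Fin (k + 2) → Fin m) =
      (Fin.cons i (p.removeNth b) : Fin (k + 1) → Fin m) := by
  ext1 j
  refine Fin.cases ?_ (fun j => ?_) j <;> simp [Fin.removeNth]

lemma removeNth_zero_cons (i : Fin m) (b : Fin (k + 1) → Fin m) :
    (0 : Fin (k + 2)).removeNth (Fin.cons i b : Fin (k + 2) → Fin m) = b := by
  ext1 j
  simp [Fin.removeNth]

lemma sign_sq (p : ℕ) (ω : M) : (-1 : ℂ) ^ p • (-1 : ℂ) ^ p • ω = ω := by
  rw [smul_smul, ← pow_add, Even.neg_one_pow ⟨_, rfl⟩, one_smul]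

lemma homotopy : del m k ∘ₗ hh m k + hh1 m k ∘ₗ del1 m k = ((k : ℂ) + 2) • LinearMap.id := by
  refine bb_ext fun i b => ?_
  rw [LinearMap.add_apply, LinearMap.comp_apply, LinearMap.comp_apply, hh_single, del1_single,
    hh1_ew, map_sum, Fin.sum_univ_succ (n := k + 1)]
  have h1 : ∀ p : Fin (k + 1), del m k ((-1 : ℂ) ^ (p : ℕ) • Pi.single s(i, b p) (ew (p.removeNth b)))
      = Pi.single i (ew b) + (-1 : ℂ) ^ (p : ℕ) •
        (Pi.single (b p) (ew (Fin.cons i (p.removeNth b) : Fin (k + 1) → Fin m)) : BB m k) := by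
    intro p
    rw [map_smul, del_single_ew, smul_add, ew_cons_remove, Pi.single_smul, sign_sq]
  simp only [h1, removeNth_zero_cons, removeNth_succ_cons, Fin.cons_zero, Fin.cons_succ]
  rw [Finset.sum_add_distrib]
  simp only [Fin.val_succ, pow_succ, mul_neg, mul_one, neg_smul, Finset.sum_neg_distrib]
  simp only [Finset.sum_const, Finset.card_univ, Fintype.card_fin, Fin.val_zero, pow_zero, one_smul,
    LinearMap.smul_apply, LinearMap.id_apply, ← Nat.cast_smul_eq_nsmul ℂ]
  push_cast
  module

lemma del1_del : del1 m k ∘ₗ del m k = 0 := by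
  refine aa_ext fun i i' a => ?_
  rw [LinearMap.comp_apply, del_single_ew, map_add, del1_single, del1_single, ew_cons_cons]
  simp

lemma del1_surj : Function.Surjective (del1 m k) := by
  rw [← LinearMap.range_eq_top, eq_top_iff, ← ew_span, Submodule.span_le]
  rintro _ ⟨b, rfl⟩
  refine ⟨Pi.single (b 0) (ew (Fin.tail b)), ?_⟩
  rw [del1_single, Fin.cons_self_tail]

lemma range_del : LinearMap.range (del m k) = LinearMap.ker (del1 m k) := by
  apply le_antisymm
  · rintro _ ⟨x, rfl⟩
    exact LinearMap.congr_fun del1_del x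
  · intro y hy
    rw [LinearMap.mem_ker] at hy
    have h := LinearMap.congr_fun (homotopy (m := m) (k := k)) y
    rw [LinearMap.add_apply, LinearMap.comp_apply, LinearMap.comp_apply, hy, map_zero, add_zero,
      LinearMap.smul_apply, LinearMap.id_apply] at h
    have h2 : ((k : ℂ) + 2) ≠ 0 := by exact_mod_cast (by omega : k + 2 ≠ 0)
    refine ⟨((k : ℂ) + 2)⁻¹ • hh m k y, ?_⟩
    rw [map_smul, h, smul_smul, inv_mul_cancel₀ h2, one_smul]

lemma rank_del (m k : ℕ) : Module.finrank ℂ (LinearMap.range (del m k)) + m.choose (k + 2) =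
    m * m.choose (k + 1) := by
  have h := LinearMap.finrank_range_add_finrank_ker (del1 m k)
  rw [LinearMap.range_eq_top.2 del1_surj, finrank_top, LL_finrank, ← range_del,
    Module.finrank_pi_fintype] at h
  simp only [LL_finrank, Finset.sum_const, Finset.card_univ, Fintype.card_fin, smul_eq_mul] at h
  omega

lemma finrank_AA (m k : ℕ) : Module.finrank ℂ (AA m k) = (m + 1).choose 2 * m.choose k := by
  rw [Module.finrank_pi_fintype]
  simp [LL_finrank, Sym2.card]

/-- the three term element -/
noncomputable def QQ (i i' l : Fin m) (b : Fin k → Fin m) : AA m (k + 1) :=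
  Pi.single s(i, i') (ew (Fin.cons l b : Fin (k + 1) → Fin m)) +
  Pi.single s(i, l) (ew (Fin.cons i' b : Fin (k + 1) → Fin m)) +
  Pi.single s(i', l) (ew (Fin.cons i b : Fin (k + 1) → Fin m))

lemma hh_single_cons (i l : Fin m) (a : Fin (k + 1) → Fin m) :
    hh m (k + 1) (Pi.single i (ew (Fin.cons l a : Fin (k + 2) → Fin m))) =
      Pi.single s(i, l) (ew a) - ∑ p : Fin (k + 1), (-1 : ℂ) ^ (p : ℕ) •
        (Pi.single s(i, a p) (ew (Fin.cons l (p.removeNth a) : Fin (k + 1) → Fin m)) :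
          AA m (k + 1)) := by
  rw [hh_single, Fin.sum_univ_succ, sub_eq_add_neg, ← Finset.sum_neg_distrib]
  congr 1
  · rw [removeNth_zero_cons, Fin.val_zero, pow_zero, one_smul]; rfl
  · refine Finset.sum_congr rfl fun p _ => ?_
    rw [removeNth_succ_cons, Fin.val_succ, pow_succ, mul_neg, mul_one, neg_smul]; rfl

lemma KK_single (i i' : Fin m) (a : Fin (k + 1) → Fin m) :
    ((k : ℂ) + 3) • (Pi.single s(i, i') (ew a) : AA m (k + 1)) -
      hh m (k + 1) (del m (k + 1) (Pi.single s(i, i') (ew a))) =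
    ∑ p : Fin (k + 1), (-1 : ℂ) ^ (p : ℕ) • QQ i i' (a p) (p.removeNth a) := by
  have hsw : (Pi.single s(i', i) (ew a) : AA m (k + 1)) = Pi.single s(i, i') (ew a) := by
    rw [Sym2.eq_swap]
  rw [del_single_ew, map_add, hh_single_cons, hh_single_cons, hsw]
  simp only [QQ, smul_add, Finset.sum_add_distrib, ew_cons_remove, Pi.single_smul, sign_sq]
  simp only [Finset.sum_const, Finset.card_univ, Fintype.card_fin, ← Nat.cast_smul_eq_nsmul ℂ]
  push_cast
  module
end

end PartF

section PartG
set_option linter.unusedSectionVars false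
open MvPolynomial TensorProduct

section
variable {m n k e : ℕ}

/-- row pair -/
def rwP (w : PermIdx m n) : Sym2 (Fin m) := s(w.1.1.1, w.1.1.2)
/-- column pair -/
def clP (w : PermIdx m n) : Sym2 (Fin n) := s(w.1.2.1, w.1.2.2)

lemma sym2_minmax (i i' : Fin m) : s(min i i', max i i') = s(i, i') := by
  rcases le_total i i' with h | h
  · rw [min_eq_left h, max_eq_right h]
  · rw [min_eq_right h, max_eq_left h, Sym2.eq_swap]

lemma rwP_wIdx (i i' : Fin m) (s s' : Fin n) : rwP (wIdx i i' s s') = s(i, i') := sym2_minmax i i'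
lemma clP_wIdx (i i' : Fin m) (s s' : Fin n) : clP (wIdx i i' s s') = s(s, s') := sym2_minmax s s'

lemma rc_inj {w w' : PermIdx m n} (h1 : rwP w = rwP w') (h2 : clP w = clP w') : w = w' := by
  rw [← wIdx_self w, ← wIdx_self w']
  simp only [rwP, clP, Sym2.eq_iff] at h1 h2
  rcases h1 with ⟨h, h'⟩ | ⟨h, h'⟩ <;> rcases h2 with ⟨g, g'⟩ | ⟨g, g'⟩ <;> rw [h, h', g, g']
  · rw [wIdx_col]
  · rw [wIdx_row]
  · rw [wIdx_row, wIdx_col]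

/-- insertion into a component -/
noncomputable def insT (k : ℕ) (w : PermIdx m n) : LL m k ⊗[ℂ] LL n k →ₗ[ℂ] AA m k ⊗[ℂ] AA n k :=
  TensorProduct.map (LinearMap.single ℂ (fun _ : Sym2 (Fin m) => LL m k) (rwP w))
    (LinearMap.single ℂ (fun _ : Sym2 (Fin n) => LL n k) (clP w))

/-- projection to a component -/
noncomputable def prjT (k : ℕ) (w : PermIdx m n) : AA m k ⊗[ℂ] AA n k →ₗ[ℂ] LL m k ⊗[ℂ] LL n k :=
  TensorProduct.map (LinearMap.proj (rwP w)) (LinearMap.proj (clP w))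

lemma prjT_insT (w w' : PermIdx m n) (x : LL m k ⊗[ℂ] LL n k) :
    prjT k w (insT k w' x) = if w' = w then x else 0 := by
  rw [prjT, insT, ← LinearMap.comp_apply, ← TensorProduct.map_comp]
  split_ifs with h
  · subst h
    rw [LinearMap.proj_comp_single_same, LinearMap.proj_comp_single_same, TensorProduct.map_id]
    rfl
  · by_cases h1 : rwP w = rwP w'
    · have h2 : clP w ≠ clP w' := fun h2 => h (rc_inj h1 h2).symm
      rw [LinearMap.proj_comp_single_ne ℂ (fun _ : Sym2 (Fin n) => LL n k) _ _ h2,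
        TensorProduct.map_zero_right]
      rfl
    · rw [LinearMap.proj_comp_single_ne ℂ (fun _ : Sym2 (Fin m) => LL m k) _ _ h1,
        TensorProduct.map_zero_left]
      rfl

/-- the comparison map -/
noncomputable def lam (m n k : ℕ) :
    (PermIdx m n → MvPolynomial (Fin m × Fin n) ℂ) →ₗ[ℂ] AA m k ⊗[ℂ] AA n k :=
  LinearMap.lsum ℂ (fun _ : PermIdx m n => MvPolynomial (Fin m × Fin n) ℂ) ℂ
    (fun w => insT k w ∘ₗ rho m n k)

lemma lam_apply (c : PermIdx m n → MvPolynomial (Fin m × Fin n) ℂ) :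
    lam m n k c = ∑ w, insT k w (rho m n k (c w)) := by
  simp [lam, LinearMap.lsum_apply]

lemma lam_single (w : PermIdx m n) (f : MvPolynomial (Fin m × Fin n) ℂ) :
    lam m n k (Pi.single w f) = insT k w (rho m n k f) := by
  rw [lam, LinearMap.lsum_piSingle]; rfl

lemma lam_mon (i i' : Fin m) (s s' : Fin n) (a : Fin k → Fin m) (b : Fin k → Fin n) :
    lam m n k (Pi.single (wIdx i i' s s') (mon a b Finset.univ)) =
      (Pi.single s(i, i') (ew a) : AA m k) ⊗ₜ[ℂ] (Pi.single s(s, s') (ew b) : AA n k) := by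
  rw [lam_single, rho_mon, insT, TensorProduct.map_tmul, rwP_wIdx, clP_wIdx]
  rfl

lemma rho_of_lam {c : PermIdx m n → MvPolynomial (Fin m × Fin n) ℂ} (h : lam m n k c = 0)
    (w : PermIdx m n) : rho m n k (c w) = 0 := by
  have h2 := congrArg (prjT k w) h
  rw [lam_apply, map_sum, map_zero] at h2
  simpa [prjT_insT] using h2

lemma lam_of_rho {c : PermIdx m n → MvPolynomial (Fin m × Fin n) ℂ}
    (h : ∀ w, rho m n k (c w) = 0) : lam m n k c = 0 := by
  rw [lam_apply]; simp [h]

lemma perm_homog (w : PermIdx m n) : (perm w).IsHomogeneous 2 :=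
  IsHomogeneous.add ((isHomogeneous_X _ _).mul (isHomogeneous_X _ _))
    ((isHomogeneous_X _ _).mul (isHomogeneous_X _ _))

lemma IL_homog {f : MvPolynomial (Fin m × Fin n) ℂ} (hf : f ∈ IL m n e) :
    f.IsHomogeneous (e + 2) := by
  have : IL m n e ≤ homogeneousSubmodule (Fin m × Fin n) ℂ (e + 2) := by
    rw [IL, Submodule.span_le]
    rintro _ ⟨q, rfl⟩
    have := (perm_homog q.1).mul (mon_isHomogeneous q.2.1 q.2.2 Finset.univ)
    rw [Finset.card_univ, Fintype.card_fin, add_comm] at this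
    exact this
  exact this hf

lemma ideal_comp {f : MvPolynomial (Fin m × Fin n) ℂ}
    (hf : f ∈ Ideal.span (Set.range (perm : PermIdx m n → _))) :
    homogeneousComponent (e + 2) f ∈ IL m n e := by
  obtain ⟨g, rfl⟩ := Ideal.mem_span_range_iff_exists_fun.1 hf
  rw [map_sum]
  refine sum_mem fun w _ => ?_
  rw [← sum_homogeneousComponent (g w), Finset.sum_mul, map_sum]
  refine sum_mem fun i _ => ?_
  have h1 := (homogeneousComponent_isHomogeneous i (g w)).mul (perm_homog w)
  rw [homogeneousComponent_of_mem h1]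
  split_ifs with h
  · obtain rfl : i = e := by omega
    rw [mul_comm]
    exact perm_mul_mem_IL w (homogeneousComponent_isHomogeneous i (g w))
  · exact zero_mem _

lemma kos_entry {c : PermIdx m n → MvPolynomial (Fin m × Fin n) ℂ} (hc : c ∈ KosModBar m n)
    (w : PermIdx m n) : c w ∈ Ideal.span (Set.range (perm : PermIdx m n → _)) := by
  have : KosModBar m n ≤ Submodule.comap
      (LinearMap.proj (R := MvPolynomial (Fin m × Fin n) ℂ)
        (φ := fun _ : PermIdx m n => MvPolynomial (Fin m × Fin n) ℂ) w)
      (Ideal.span (Set.range (perm : PermIdx m n → _))) := by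
    rw [KosModBar, Submodule.span_le]
    rintro _ ⟨u, u', rfl⟩
    change (Pi.single u (perm u') : PermIdx m n → _) w - (Pi.single u' (perm u) : PermIdx m n → _) w
      ∈ Ideal.span (Set.range (perm : PermIdx m n → _))
    refine sub_mem ?_ ?_ <;> rw [Pi.single_apply] <;> split_ifs <;>
      first | exact zero_mem _ | exact Ideal.subset_span ⟨_, rfl⟩
  exact this hc

lemma lam_eq_zero_iff (he : 1 ≤ e) {c : PermIdx m n → MvPolynomial (Fin m × Fin n) ℂ}
    (hc : c ∈ SyzBar m n (e + 4)) : lam m n (e + 2) c = 0 ↔ c ∈ KosBar m n (e + 4) := by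
  constructor
  · intro h
    refine ⟨hc, syz_mem_kos he c (fun w => mem_IL_of_rho (hc.1 w) (rho_of_lam h w)) hc.2⟩
  · intro h
    refine lam_of_rho fun w => rho_IL ?_
    have := ideal_comp (e := e) (kos_entry h.2 w)
    rwa [homogeneousComponent_of_mem (hc.1 w), if_pos (by omega)] at this

/-- the derivative map -/
noncomputable def Th (m n k : ℕ) : MvPolynomial (Fin m × Fin n) ℂ →ₗ[ℂ] BB m k ⊗[ℂ] BB n k :=
  ∑ z : Fin m × Fin n, TensorProduct.map
    (LinearMap.single ℂ (fun _ : Fin m => LL m (k + 1)) z.1)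
    (LinearMap.single ℂ (fun _ : Fin n => LL n (k + 1)) z.2) ∘ₗ rho m n (k + 1) ∘ₗ
      (pderiv z).toLinearMap

lemma Th_X (q : Fin m × Fin n) (f : MvPolynomial (Fin m × Fin n) ℂ) :
    ∑ z : Fin m × Fin n, TensorProduct.map
    (LinearMap.single ℂ (fun _ : Fin m => LL m (k + 1)) z.1)
    (LinearMap.single ℂ (fun _ : Fin n => LL n (k + 1)) z.2) (rho m n (k + 1) (pderiv z (X q) * f)) =
    TensorProduct.map
    (LinearMap.single ℂ (fun _ : Fin m => LL m (k + 1)) q.1)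
    (LinearMap.single ℂ (fun _ : Fin n => LL n (k + 1)) q.2) (rho m n (k + 1) f) := by
  classical
  rw [Finset.sum_eq_single q]
  · rw [pderiv_X_self, one_mul]
  · intro z _ hz
    rw [pderiv_X_of_ne hz.symm, zero_mul, map_zero, map_zero]
  · simp

lemma Th_mul (i i' : Fin m) (s s' : Fin n) (a : Fin (e + 2) → Fin m) (b : Fin (e + 2) → Fin n) :
    Th m n (e + 2) (mon a b Finset.univ * perm (wIdx i i' s s')) =
    TensorProduct.map (del m (e + 2)) (del n (e + 2))
      (lam m n (e + 2) (Pi.single (wIdx i i' s s') (mon a b Finset.univ))) := by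
  have h1 : ∀ z : Fin m × Fin n, rho m n (e + 2 + 1)
      (pderiv z (mon a b Finset.univ * perm (wIdx i i' s s'))) =
      rho m n (e + 2 + 1) (pderiv z (X (i, s)) * (X (i', s') * mon a b Finset.univ)) +
      rho m n (e + 2 + 1) (pderiv z (X (i', s')) * (X (i, s) * mon a b Finset.univ)) +
      rho m n (e + 2 + 1) (pderiv z (X (i, s')) * (X (i', s) * mon a b Finset.univ)) +
      rho m n (e + 2 + 1) (pderiv z (X (i', s)) * (X (i, s') * mon a b Finset.univ)) := by
    intro z
    have h0 : rho m n (e + 1 + 2) (perm (wIdx i i' s s') * pderiv z (mon a b Finset.univ)) = 0 := by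
      apply rho_IL
      apply perm_mul_mem_IL
      have := (mon_isHomogeneous a b Finset.univ).pderiv (i := z)
      simpa using this
    rw [← map_add, ← map_add, ← map_add]
    rw [Derivation.leibniz, map_add, smul_eq_mul, smul_eq_mul]
    have h0' : rho m n (e + 2 + 1) (perm (wIdx i i' s s') * pderiv z (mon a b Finset.univ)) = 0 := h0
    rw [h0', add_zero, perm_wIdx]
    congr 1
    rw [map_add, Derivation.leibniz, Derivation.leibniz]
    simp only [smul_eq_mul]
    ring
  rw [Th, LinearMap.sum_apply]
  simp only [LinearMap.comp_apply]
  have h2 : ∀ z : Fin m × Fin n, (pderiv z).toLinearMap (mon a b Finset.univ * perm (wIdx i i' s s'))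
    = pderiv z (mon a b Finset.univ * perm (wIdx i i' s s')) := fun _ => rfl
  simp only [h2, h1, map_add, Finset.sum_add_distrib, Th_X]
  rw [← mon_cons, ← mon_cons, ← mon_cons, ← mon_cons, rho_mon, rho_mon, rho_mon, rho_mon, lam_mon]
  simp only [TensorProduct.map_tmul, del_single_ew, TensorProduct.add_tmul, TensorProduct.tmul_add,
    LinearMap.single_apply]
  abel

lemma lam_syz {c : PermIdx m n → MvPolynomial (Fin m × Fin n) ℂ} (hc : c ∈ SyzBar m n (e + 4)) :
    TensorProduct.map (del m (e + 2)) (del n (e + 2)) (lam m n (e + 2) c) = 0 := by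
  have h1 : ∀ (w : PermIdx m n) (f), f ∈ Hm m n (e + 2) → Th m n (e + 2) (f * perm w) =
      TensorProduct.map (del m (e + 2)) (del n (e + 2)) (lam m n (e + 2) (Pi.single w f)) := by
    intro w f hf
    induction hf using Submodule.span_induction with
    | mem x hx =>
      obtain ⟨q, rfl⟩ := hx
      have := Th_mul w.1.1.1 w.1.1.2 w.1.2.1 w.1.2.2 q.1 q.2
      rwa [wIdx_self] at this
    | zero => simp
    | add x y _ _ hx hy => rw [add_mul, map_add, hx, hy, Pi.single_add, map_add, map_add]
    | smul r x _ hx => rw [smul_mul_assoc, map_smul, hx, Pi.single_smul, map_smul, map_smul]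
  have h2 : c = ∑ w, Pi.single w (c w) := (Finset.univ_sum_single c).symm
  rw [h2, map_sum, map_sum, ← Finset.sum_congr rfl fun w _ => h1 w (c w) (by
    rw [Hm_eq]; exact hc.1 w), ← map_sum, hc.2, map_zero]
end

end PartG

section PartH
set_option linter.unusedSectionVars false
open MvPolynomial TensorProduct

section
variable {m n e : ℕ}

/-- the relation map -/
noncomputable def piL (m n : ℕ) : (PermIdx m n → MvPolynomial (Fin m × Fin n) ℂ) →ₗ[ℂ]
    MvPolynomial (Fin m × Fin n) ℂ :=
  LinearMap.lsum ℂ (fun _ : PermIdx m n => MvPolynomial (Fin m × Fin n) ℂ) ℂ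
    (fun w => LinearMap.mulRight ℂ (perm w))

lemma piL_apply (c : PermIdx m n → MvPolynomial (Fin m × Fin n) ℂ) :
    piL m n c = ∑ w, c w * perm w := by
  simp [piL, LinearMap.lsum_apply]

lemma piL_single (w : PermIdx m n) (f : MvPolynomial (Fin m × Fin n) ℂ) :
    piL m n (Pi.single w f) = f * perm w := by
  rw [piL, LinearMap.lsum_piSingle]; rfl

/-- families with entries in a subspace -/
noncomputable def famS (U : Submodule ℂ (MvPolynomial (Fin m × Fin n) ℂ)) :
    Submodule ℂ (PermIdx m n → MvPolynomial (Fin m × Fin n) ℂ) := Submodule.pi Set.univ fun _ => U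

lemma famS_iff {U : Submodule ℂ (MvPolynomial (Fin m × Fin n) ℂ)}
    {c : PermIdx m n → MvPolynomial (Fin m × Fin n) ℂ} : c ∈ famS U ↔ ∀ w, c w ∈ U := by
  simp [famS, Submodule.mem_pi]

lemma famS_single {U : Submodule ℂ (MvPolynomial (Fin m × Fin n) ℂ)} (w : PermIdx m n)
    {f : MvPolynomial (Fin m × Fin n) ℂ} (hf : f ∈ U) : (Pi.single w f : PermIdx m n → _) ∈ famS U := by
  rw [famS_iff]
  intro w'
  rw [Pi.single_apply]
  split_ifs
  · exact hf
  · exact zero_mem _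

lemma mon_mem_Hm {k : ℕ} (a : Fin k → Fin m) (b : Fin k → Fin n) :
    mon a b Finset.univ ∈ Hm m n k := Submodule.subset_span ⟨(a, b), rfl⟩

lemma lift_syz {q g : PermIdx m n → MvPolynomial (Fin m × Fin n) ℂ} (hq : q ∈ famS (Hm m n (e + 2)))
    (hg : g ∈ famS (IL m n e)) (h : piL m n q = piL m n g) :
    lam m n (e + 2) q ∈ (SyzBar m n (e + 4)).map (lam m n (e + 2)) := by
  rw [famS_iff] at hq hg
  refine ⟨q - g, ⟨fun w => ?_, ?_⟩, ?_⟩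
  · have := hq w
    rw [Hm_eq] at this
    exact sub_mem this (IL_homog (hg w))
  · rw [← piL_apply, map_sub, h, sub_self]
  · rw [map_sub, lam_of_rho (c := g) fun w => rho_IL (hg w), sub_zero]

/-- auxiliary lift for rows -/
noncomputable def GR (i i' l r : Fin m) (s t b c : Fin n) (f : MvPolynomial (Fin m × Fin n) ℂ) :
    PermIdx m n → MvPolynomial (Fin m × Fin n) ℂ :=
  Pi.single (wIdx i i' s t) (perm (wIdx l r b c) * f) +
  Pi.single (wIdx i l s t) (perm (wIdx i' r b c) * f) +
  Pi.single (wIdx i' l s t) (perm (wIdx i r b c) * f)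

/-- auxiliary lift for columns -/
noncomputable def GC (i i' l r : Fin m) (s t b c : Fin n) (f : MvPolynomial (Fin m × Fin n) ℂ) :
    PermIdx m n → MvPolynomial (Fin m × Fin n) ℂ :=
  Pi.single (wIdx i i' s t) (perm (wIdx l r b c) * f) +
  Pi.single (wIdx i i' s b) (perm (wIdx l r t c) * f) +
  Pi.single (wIdx i i' t b) (perm (wIdx l r s c) * f)

lemma GR_mem (i i' l r : Fin m) (s t b c : Fin n) {f : MvPolynomial (Fin m × Fin n) ℂ}
    (hf : f.IsHomogeneous e) : GR i i' l r s t b c f ∈ famS (IL m n e) :=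
  add_mem (add_mem (famS_single _ (perm_mul_mem_IL _ hf)) (famS_single _ (perm_mul_mem_IL _ hf)))
    (famS_single _ (perm_mul_mem_IL _ hf))

lemma GC_mem (i i' l r : Fin m) (s t b c : Fin n) {f : MvPolynomial (Fin m × Fin n) ℂ}
    (hf : f.IsHomogeneous e) : GC i i' l r s t b c f ∈ famS (IL m n e) :=
  add_mem (add_mem (famS_single _ (perm_mul_mem_IL _ hf)) (famS_single _ (perm_mul_mem_IL _ hf)))
    (famS_single _ (perm_mul_mem_IL _ hf))

lemma half_eq {V : Type*} [AddCommGroup V] [Module ℂ V] {x y : V} (h : (2 : ℂ) • x = y) :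
    x = (1 / 2 : ℂ) • y := by
  rw [← h, smul_smul]; norm_num

lemma QQ_row (i i' l r : Fin m) (b : Fin e → Fin m) (s t u0 u1 : Fin n) (u : Fin e → Fin n) :
    (QQ i i' l (Fin.cons r b : Fin (e + 1) → Fin m)) ⊗ₜ[ℂ] (Pi.single s(s, t)
      (ew (Fin.cons u0 (Fin.cons u1 u : Fin (e + 1) → Fin n) : Fin (e + 2) → Fin n)) : AA n (e + 2))
    ∈ (SyzBar m n (e + 4)).map (lam m n (e + 2)) := by
  have hf : (mon b u Finset.univ).IsHomogeneous e := by
    have := mon_isHomogeneous b u Finset.univ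
    simpa using this
  have h := lift_syz (m := m) (n := n) (e := e)
    (q := Pi.single (wIdx i i' s t) (mon (Fin.cons l (Fin.cons r b : Fin (e + 1) → Fin m) : Fin (e + 2) → Fin m)
      (Fin.cons u0 (Fin.cons u1 u : Fin (e + 1) → Fin n) : Fin (e + 2) → Fin n) Finset.univ) +
      Pi.single (wIdx i l s t) (mon (Fin.cons i' (Fin.cons r b : Fin (e + 1) → Fin m) : Fin (e + 2) → Fin m)
      (Fin.cons u0 (Fin.cons u1 u : Fin (e + 1) → Fin n) : Fin (e + 2) → Fin n) Finset.univ) +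
      Pi.single (wIdx i' l s t) (mon (Fin.cons i (Fin.cons r b : Fin (e + 1) → Fin m) : Fin (e + 2) → Fin m)
      (Fin.cons u0 (Fin.cons u1 u : Fin (e + 1) → Fin n) : Fin (e + 2) → Fin n) Finset.univ))
    (g := (1 / 2 : ℂ) • (GR i i' l r s t u0 u1 (mon b u Finset.univ) -
      GR i i' l r s u1 t u0 (mon b u Finset.univ) + GR i i' l r s u0 u1 t (mon b u Finset.univ)))
    (add_mem (add_mem (famS_single _ (mon_mem_Hm _ _)) (famS_single _ (mon_mem_Hm _ _)))
      (famS_single _ (mon_mem_Hm _ _)))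
    (Submodule.smul_mem _ _ (add_mem (sub_mem (GR_mem _ _ _ _ _ _ _ _ hf) (GR_mem _ _ _ _ _ _ _ _ hf))
      (GR_mem _ _ _ _ _ _ _ _ hf)))
    (by
      rw [map_smul]
      apply half_eq
      simp only [GR, map_add, map_sub, piL_single, mon_cons, perm_wIdx, two_smul]
      ring)
  rw [map_add, map_add, lam_mon, lam_mon, lam_mon, ← TensorProduct.add_tmul,
    ← TensorProduct.add_tmul] at h
  exact h

lemma QQ_col (s s' t r : Fin n) (u : Fin e → Fin n) (i i' a0 a1 : Fin m) (a : Fin e → Fin m) :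
    (Pi.single s(i, i')
      (ew (Fin.cons a0 (Fin.cons a1 a : Fin (e + 1) → Fin m) : Fin (e + 2) → Fin m)) : AA m (e + 2))
      ⊗ₜ[ℂ] (QQ s s' t (Fin.cons r u : Fin (e + 1) → Fin n))
    ∈ (SyzBar m n (e + 4)).map (lam m n (e + 2)) := by
  have hf : (mon a u Finset.univ).IsHomogeneous e := by
    have := mon_isHomogeneous a u Finset.univ
    simpa using this
  have h := lift_syz (m := m) (n := n) (e := e)
    (q := Pi.single (wIdx i i' s s') (mon (Fin.cons a0 (Fin.cons a1 a : Fin (e + 1) → Fin m) : Fin (e + 2) → Fin m)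
      (Fin.cons t (Fin.cons r u : Fin (e + 1) → Fin n) : Fin (e + 2) → Fin n) Finset.univ) +
      Pi.single (wIdx i i' s t) (mon (Fin.cons a0 (Fin.cons a1 a : Fin (e + 1) → Fin m) : Fin (e + 2) → Fin m)
      (Fin.cons s' (Fin.cons r u : Fin (e + 1) → Fin n) : Fin (e + 2) → Fin n) Finset.univ) +
      Pi.single (wIdx i i' s' t) (mon (Fin.cons a0 (Fin.cons a1 a : Fin (e + 1) → Fin m) : Fin (e + 2) → Fin m)
      (Fin.cons s (Fin.cons r u : Fin (e + 1) → Fin n) : Fin (e + 2) → Fin n) Finset.univ))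
    (g := (1 / 2 : ℂ) • (GC i i' a0 a1 s s' t r (mon a u Finset.univ) -
      GC i a1 i' a0 s s' t r (mon a u Finset.univ) + GC i a0 a1 i' s s' t r (mon a u Finset.univ)))
    (add_mem (add_mem (famS_single _ (mon_mem_Hm _ _)) (famS_single _ (mon_mem_Hm _ _)))
      (famS_single _ (mon_mem_Hm _ _)))
    (Submodule.smul_mem _ _ (add_mem (sub_mem (GC_mem _ _ _ _ _ _ _ _ hf) (GC_mem _ _ _ _ _ _ _ _ hf))
      (GC_mem _ _ _ _ _ _ _ _ hf)))
    (by
      rw [map_smul]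
      apply half_eq
      simp only [GC, map_add, map_sub, piL_single, mon_cons, perm_wIdx, two_smul]
      ring)
  rw [map_add, map_add, lam_mon, lam_mon, lam_mon, ← TensorProduct.tmul_add,
    ← TensorProduct.tmul_add] at h
  exact h

/-- the complementary operator -/
noncomputable def KK (m e : ℕ) : AA m (e + 2) →ₗ[ℂ] AA m (e + 2) :=
  ((e : ℂ) + 4) • LinearMap.id - hh m (e + 2) ∘ₗ del m (e + 2)

lemma KK_eq (i i' : Fin m) (a : Fin (e + 2) → Fin m) : KK m e (Pi.single s(i, i') (ew a)) =
    ∑ p : Fin (e + 2), (-1 : ℂ) ^ (p : ℕ) • QQ i i' (a p) (p.removeNth a) := by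
  rw [← KK_single]
  simp only [KK, LinearMap.sub_apply, LinearMap.smul_apply, LinearMap.id_apply, LinearMap.comp_apply]
  push_cast
  congr 2
  ring

lemma exists_cons {k : ℕ} (b : Fin (k + 1) → Fin m) : ∃ r c, b = (Fin.cons r c : Fin (k + 1) → Fin m) :=
  ⟨b 0, Fin.tail b, (Fin.cons_self_tail b).symm⟩

lemma KK_row (x : AA m (e + 2)) (y : AA n (e + 2)) :
    (KK m e x) ⊗ₜ[ℂ] y ∈ (SyzBar m n (e + 4)).map (lam m n (e + 2)) := by
  set U := (SyzBar m n (e + 4)).map (lam m n (e + 2)) with hU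
  have h : ((TensorProduct.mk ℂ (AA m (e + 2)) (AA n (e + 2))).compr₂ U.mkQ) ∘ₗ KK m e = 0 := by
    refine aa_ext fun i i' a => aa_ext fun s t u => ?_
    change U.mkQ ((KK m e (Pi.single s(i, i') (ew a))) ⊗ₜ[ℂ] Pi.single s(s, t) (ew u)) = 0
    refine (Submodule.Quotient.mk_eq_zero _).2 ?_
    rw [KK_eq, TensorProduct.sum_tmul]
    refine sum_mem fun p _ => ?_
    rw [← TensorProduct.smul_tmul']
    refine Submodule.smul_mem _ _ ?_
    obtain ⟨r, b, hb⟩ := exists_cons (p.removeNth a)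
    obtain ⟨u0, u', rfl⟩ := exists_cons u
    obtain ⟨u1, u, rfl⟩ := exists_cons u'
    rw [hb]
    exact QQ_row _ _ _ _ _ _ _ _ _ _
  exact (Submodule.Quotient.mk_eq_zero _).1 (LinearMap.congr_fun (LinearMap.congr_fun h x) y)

lemma KK_col (x : AA m (e + 2)) (y : AA n (e + 2)) :
    x ⊗ₜ[ℂ] (KK n e y) ∈ (SyzBar m n (e + 4)).map (lam m n (e + 2)) := by
  set U := (SyzBar m n (e + 4)).map (lam m n (e + 2)) with hU
  have h : (((TensorProduct.mk ℂ (AA m (e + 2)) (AA n (e + 2))).compr₂ U.mkQ).compl₂ (KK n e)) = 0 := by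
    refine aa_ext fun i i' a => aa_ext fun s t u => ?_
    change U.mkQ ((Pi.single s(i, i') (ew a)) ⊗ₜ[ℂ] (KK n e (Pi.single s(s, t) (ew u)))) = 0
    refine (Submodule.Quotient.mk_eq_zero _).2 ?_
    rw [KK_eq, TensorProduct.tmul_sum]
    refine sum_mem fun p _ => ?_
    rw [TensorProduct.tmul_smul]
    refine Submodule.smul_mem _ _ ?_
    obtain ⟨r, b, hb⟩ := exists_cons (p.removeNth u)
    obtain ⟨u0, u', rfl⟩ := exists_cons a
    obtain ⟨u1, a, rfl⟩ := exists_cons u'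
    rw [hb]
    exact QQ_col _ _ _ _ _ _ _ _ _ _
  exact (Submodule.Quotient.mk_eq_zero _).1 (LinearMap.congr_fun (LinearMap.congr_fun h x) y)

lemma KK_row' (t : AA m (e + 2) ⊗[ℂ] AA n (e + 2)) :
    TensorProduct.map (KK m e) LinearMap.id t ∈ (SyzBar m n (e + 4)).map (lam m n (e + 2)) := by
  induction t using TensorProduct.induction_on with
  | zero => rw [map_zero]; exact zero_mem _
  | tmul x y => rw [TensorProduct.map_tmul]; exact KK_row x y
  | add x y hx hy => rw [map_add]; exact add_mem hx hy

lemma KK_col' (t : AA m (e + 2) ⊗[ℂ] AA n (e + 2)) :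
    TensorProduct.map LinearMap.id (KK n e) t ∈ (SyzBar m n (e + 4)).map (lam m n (e + 2)) := by
  induction t using TensorProduct.induction_on with
  | zero => rw [map_zero]; exact zero_mem _
  | tmul x y => rw [TensorProduct.map_tmul]; exact KK_col x y
  | add x y hx hy => rw [map_add]; exact add_mem hx hy

lemma map_sub_left' {A B A' B' : Type*} [AddCommGroup A] [AddCommGroup B] [AddCommGroup A']
    [AddCommGroup B'] [Module ℂ A] [Module ℂ B] [Module ℂ A'] [Module ℂ B']
    (f f' : A →ₗ[ℂ] B) (g : A' →ₗ[ℂ] B') :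
    TensorProduct.map (f - f') g = TensorProduct.map f g - TensorProduct.map f' g := by
  ext x y
  simp [TensorProduct.sub_tmul]

lemma map_sub_right' {A B A' B' : Type*} [AddCommGroup A] [AddCommGroup B] [AddCommGroup A']
    [AddCommGroup B'] [Module ℂ A] [Module ℂ B] [Module ℂ A'] [Module ℂ B']
    (f : A →ₗ[ℂ] B) (g g' : A' →ₗ[ℂ] B') :
    TensorProduct.map f (g - g') = TensorProduct.map f g - TensorProduct.map f g' := by
  ext x y
  simp [TensorProduct.tmul_sub]

lemma ker_eq : LinearMap.ker (TensorProduct.map (del m (e + 2)) (del n (e + 2))) =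
    (SyzBar m n (e + 4)).map (lam m n (e + 2)) := by
  apply le_antisymm
  · intro r hr
    rw [LinearMap.mem_ker] at hr
    set d : ℂ := (e : ℂ) + 4 with hd
    have hd0 : d ≠ 0 := by rw [hd]; exact_mod_cast (by omega : e + 4 ≠ 0)
    set r' := TensorProduct.map (hh m (e + 2) ∘ₗ del m (e + 2)) LinearMap.id r with hr'
    have h1 : TensorProduct.map (KK m e) LinearMap.id r = d • r - r' := by
      rw [KK, map_sub_left', TensorProduct.map_smul_left, TensorProduct.map_id]
      rfl
    have h3 : TensorProduct.map (LinearMap.id : AA m (e + 2) →ₗ[ℂ] _)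
        (hh n (e + 2) ∘ₗ del n (e + 2)) r' = 0 := by
      rw [hr', ← LinearMap.comp_apply, ← TensorProduct.map_comp, LinearMap.id_comp,
        LinearMap.comp_id, TensorProduct.map_comp, LinearMap.comp_apply, hr, map_zero]
    have h2 : TensorProduct.map LinearMap.id (KK n e) r' = d • r' := by
      rw [KK, map_sub_right', TensorProduct.map_smul_right, TensorProduct.map_id,
        LinearMap.sub_apply, h3, sub_zero]
      rfl
    have h4 : r = (d * d)⁻¹ • (d • TensorProduct.map (KK m e) LinearMap.id r +
        TensorProduct.map LinearMap.id (KK n e) r') := by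
      rw [h1, h2, smul_sub, sub_add_cancel, smul_smul, smul_smul, mul_assoc,
        inv_mul_cancel₀ (mul_ne_zero hd0 hd0), one_smul]
    rw [h4]
    exact Submodule.smul_mem _ _ (add_mem (Submodule.smul_mem _ _ (KK_row' r)) (KK_col' r'))
  · rintro _ ⟨c, hc, rfl⟩
    exact lam_syz hc

lemma finrank_range_map {A B A' B' : Type*} [AddCommGroup A] [AddCommGroup B] [AddCommGroup A']
    [AddCommGroup B'] [Module ℂ A] [Module ℂ B] [Module ℂ A'] [Module ℂ B']
    (f : A →ₗ[ℂ] B) (g : A' →ₗ[ℂ] B') :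
    Module.finrank ℂ (LinearMap.range (TensorProduct.map f g)) =
      Module.finrank ℂ (LinearMap.range f) * Module.finrank ℂ (LinearMap.range g) := by
  have h1 : TensorProduct.map f g =
      TensorProduct.map (LinearMap.range f).subtype (LinearMap.range g).subtype ∘ₗ
      TensorProduct.map f.rangeRestrict g.rangeRestrict := by
    rw [← TensorProduct.map_comp]; rfl
  have h2 : Function.Surjective (TensorProduct.map f.rangeRestrict g.rangeRestrict) :=
    TensorProduct.map_surjective f.surjective_rangeRestrict g.surjective_rangeRestrict
  have h3 : Function.Injective
      (TensorProduct.map (LinearMap.range f).subtype (LinearMap.range g).subtype) :=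
    TensorProduct.map_injective_of_flat_flat _ _ Subtype.val_injective Subtype.val_injective
  rw [h1, LinearMap.range_comp_of_range_eq_top _ (LinearMap.range_eq_top.2 h2),
    LinearMap.finrank_range_of_inj h3, Module.finrank_tensorProduct]

lemma finrank_quot (he : 1 ≤ e) :
    Module.finrank ℂ (↥(SyzBar m n (e + 4)) ⧸ Submodule.comap (SyzBar m n (e + 4)).subtype
      (KosBar m n (e + 4))) +
    Module.finrank ℂ (LinearMap.range (del m (e + 2))) *
      Module.finrank ℂ (LinearMap.range (del n (e + 2))) =
    ((m + 1).choose 2 * m.choose (e + 2)) * ((n + 1).choose 2 * n.choose (e + 2)) := by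
  have hk : Submodule.comap (SyzBar m n (e + 4)).subtype (KosBar m n (e + 4)) =
      LinearMap.ker ((lam m n (e + 2)).domRestrict (SyzBar m n (e + 4))) := by
    ext ⟨c, hc⟩
    rw [LinearMap.mem_ker, Submodule.mem_comap]
    exact (lam_eq_zero_iff he hc).symm
  rw [hk, ((lam m n (e + 2)).domRestrict (SyzBar m n (e + 4))).quotKerEquivRange.finrank_eq,
    LinearMap.range_domRestrict, ← ker_eq, ← finrank_range_map, add_comm,
    LinearMap.finrank_range_add_finrank_ker, Module.finrank_tensorProduct, finrank_AA, finrank_AA]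

lemma numG {m e R : ℕ} (hm : 1 ≤ m) (hR : R + m.choose (e + 4) = m * m.choose (e + 3)) :
    (e + 4) * R = m * (m + 1) * (m - 1).choose (e + 2) := by
  obtain ⟨M, rfl⟩ := Nat.exists_eq_add_of_le' hm
  simp only [Nat.add_sub_cancel]
  have h1 := Nat.add_one_mul_choose_eq M (e + 2)
  have h2 := Nat.choose_succ_right_eq (M + 1) (e + 3)
  rcases le_or_gt (e + 3) (M + 1) with h | h
  · obtain ⟨j, hj⟩ := Nat.exists_eq_add_of_le h
    have h3 : M + 1 - (e + 3) = j := by omega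
    rw [h3] at h2
    have hj' : M = e + 2 + j := by omega
    subst hj'
    zify at *
    have h1' : ((e : ℤ) + 2 + j + 1) * ((e + 2 + j).choose (e + 2) : ℕ) =
      ((e + 2 + j + 1).choose (e + 3) : ℕ) * (e + 3) := by
      have := h1; linarith
    push_cast at *
    linear_combination (e + 4 : ℤ) * hR - h2 - ((e : ℤ) + 2 + j + 1 + 1) * h1'
  · have h4 : M.choose (e + 2) = 0 := Nat.choose_eq_zero_of_lt (by omega)
    have h5 : (M + 1).choose (e + 3) = 0 := Nat.choose_eq_zero_of_lt (by omega)
    rw [h5] at hR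
    have : R = 0 := by omega
    simp [this, h4]

lemma numF {m e R : ℕ} (hm : 1 ≤ m) (hR : (e + 4) * R = m * (m + 1) * (m - 1).choose (e + 2)) :
    2 * (e + 4) * ((m + 1).choose 2 * m.choose (e + 2)) =
      m * (m + 1) * (m + 2) * (m - 1).choose (e + 1) + 2 * (e + 4) * R := by
  obtain ⟨M, rfl⟩ := Nat.exists_eq_add_of_le' hm
  simp only [Nat.add_sub_cancel] at *
  have h0 : 2 * (M + 1 + 1).choose 2 = (M + 1) * (M + 2) := by
    have := Nat.add_one_mul_choose_eq (M + 1) 1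
    rw [Nat.choose_one_right] at this
    linarith
  have h1 := Nat.choose_succ_succ M (e + 1)
  have h2 := Nat.choose_succ_right_eq M (e + 1)
  simp only [Nat.succ_eq_add_one] at h1
  have h3 : M.choose (e + 1) * (M - (e + 1)) + M.choose (e + 1) * (e + 1) = M.choose (e + 1) * M := by
    rcases le_or_gt (e + 1) M with h | h
    · rw [← mul_add]; congr 1; omega
    · rw [Nat.choose_eq_zero_of_lt h]; simp
  rw [← h2] at h3
  have h1' : (M + 1).choose (e + 2) = M.choose (e + 1) + M.choose (e + 2) := h1
  rw [h1']
  have h3' : M.choose (e + 2) * (e + 2) + M.choose (e + 1) * (e + 1) = M.choose (e + 1) * M := h3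
  zify at *
  linear_combination ((e : ℤ) + 4) * (M.choose (e + 1) + M.choose (e + 2)) * h0 - 2 * hR +
    ((M : ℤ) + 1) * (M + 2) * h3'

lemma numFG {m e R F G : ℕ} (hm : 1 ≤ m) (hR : R + m.choose (e + 4) = m * m.choose (e + 3))
    (hF : F = m * (m + 1) * (m + 2) * (m - 1).choose (e + 1) / (2 * (e + 4)))
    (hG : G = m * (m + 1) * (m - 1).choose (e + 2) / (e + 4)) :
    G = R ∧ (m + 1).choose 2 * m.choose (e + 2) = F + R := by
  have h1 := numG hm hR
  have h2 := numF hm h1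
  refine ⟨by rw [hG, ← h1, Nat.mul_div_cancel_left _ (by omega)], ?_⟩
  have h3 : R ≤ (m + 1).choose 2 * m.choose (e + 2) := by
    refine le_of_mul_le_mul_left (a := 2 * (e + 4)) ?_ (by omega)
    rw [h2]; exact Nat.le_add_left _ _
  obtain ⟨q, hq⟩ := Nat.exists_eq_add_of_le h3
  rw [hq, mul_add] at h2
  have h4 : m * (m + 1) * (m + 2) * (m - 1).choose (e + 1) = 2 * (e + 4) * q := by linarith
  rw [hF, h4, Nat.mul_div_cancel_left _ (by omega), hq, add_comm]
end

end PartH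

/-- For `d ≥ 5`, with `F(k) = k(k+1)(k+2)·C(k−1, d−3)/(2d)` and
`G(k) = k(k+1)·C(k−1, d−2)/d`, the degree-`d` part of the first Koszul homology
of the generalized 2×2 permanents, `Syz̄_d / Kos̄_d`, has dimension
`F(m)F(n) + F(m)G(n) + G(m)F(n)`. -/
theorem dim_koszul_homology_permanents_high_degree (m n : ℕ) (hm : 1 ≤ m) (hn : 1 ≤ n)
    (d : ℕ) (hd : 5 ≤ d) (F G : ℕ → ℕ)
    (hF : ∀ k, F k = k * (k + 1) * (k + 2) * Nat.choose (k - 1) (d - 3) / (2 * d))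
    (hG : ∀ k, G k = k * (k + 1) * Nat.choose (k - 1) (d - 2) / d) :
    Module.finrank ℂ
      (↥(SyzBar m n d) ⧸ Submodule.comap (SyzBar m n d).subtype (KosBar m n d)) =
      F m * F n + F m * G n + G m * F n := by
  obtain ⟨e, rfl⟩ : ∃ e, d = e + 4 := ⟨d - 4, by omega⟩
  have h := finrank_quot (m := m) (n := n) (e := e) (by omega)
  obtain ⟨h1, h2⟩ := numFG hm (rank_del m (e + 2)) (hF m) (hG m)
  obtain ⟨h3, h4⟩ := numFG hn (rank_del n (e + 2)) (hF n) (hG n)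
  rw [h2, h4, ← h1, ← h3] at h
  have h5 : (F m + G m) * (F n + G n) = F m * F n + F m * G n + G m * F n + G m * G n := by ring
  omega
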